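/- arXiv:1802.07394 — 7 statements merged into one kernel-verified Lean document; each statement's English description precedes it below -/
import Mathlib

section
/- Let n ≥ 1, k ≥ 1, and let P₁, …, P_r be orthogonal projections in M_n(ℂ), each of rank at most k, satisfying P₁ + ⋯ + P_r = I_n. Then the operator system 𝒱 = span_ℂ(P₁, …, P_r) has no quantum (k+1)-anticlique, i.e., there is no rank-(k+1) orthogonal projection P with dim(P𝒱P) = 1. -/
open Matrix

/-- An operator system: a subspace of matrices containing the identity and
closed under conjugate transpose. -/
def IsOperatorSystem {ι : Type*} [Fintype ι] [DecidableEq ι]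
    (V : Submodule ℂ (Matrix ι ι ℂ)) : Prop :=
  (1 : Matrix ι ι ℂ) ∈ V ∧ ∀ A ∈ V, Aᴴ ∈ V

/-- An orthogonal projection: `P = P² = P*`. -/
def IsOrthogonalProjection {ι : Type*} [Fintype ι] [DecidableEq ι]
    (P : Matrix ι ι ℂ) : Prop :=
  P * P = P ∧ Pᴴ = P

/-- The compression `PVP = {PAP : A ∈ V}`. -/
noncomputable def compress {ι : Type*} [Fintype ι] [DecidableEq ι]
    (P : Matrix ι ι ℂ) (V : Submodule ℂ (Matrix ι ι ℂ)) :
    Submodule ℂ (Matrix ι ι ℂ) :=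
  V.map ((LinearMap.mulLeft ℂ P).comp (LinearMap.mulRight ℂ P))

/-- `V` has a quantum `k`-anticlique: a rank-`k` orthogonal projection `P`
with `dim (PVP) = 1`. -/
def HasQuantumAnticlique {ι : Type*} [Fintype ι] [DecidableEq ι]
    (V : Submodule ℂ (Matrix ι ι ℂ)) (k : ℕ) : Prop :=
  ∃ P : Matrix ι ι ℂ, IsOrthogonalProjection P ∧ P.rank = k ∧
    Module.finrank ℂ (compress P V) = 1

/-- `V` has a quantum `k`-clique: a rank-`k` orthogonal projection `P`
with `dim (PVP) = k²`. -/
def HasQuantumClique {ι : Type*} [Fintype ι] [DecidableEq ι]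
    (V : Submodule ℂ (Matrix ι ι ℂ)) (k : ℕ) : Prop :=
  ∃ P : Matrix ι ι ℂ, IsOrthogonalProjection P ∧ P.rank = k ∧
    Module.finrank ℂ (compress P V) = k ^ 2

/-- If a compression by `Q ≠ 0` is one-dimensional and `V` contains the identity, then every
compressed element is a scalar multiple of `Q`. -/
lemma exists_smul_eq_of_finrank_compress_eq_one {ι : Type*} [Fintype ι] [DecidableEq ι]
    {Q : Matrix ι ι ℂ} {V : Submodule ℂ (Matrix ι ι ℂ)} (hQ : Q * Q = Q) (hQ0 : Q ≠ 0)
    (hV : (1 : Matrix ι ι ℂ) ∈ V) (hdim : Module.finrank ℂ (compress Q V) = 1)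
    {A : Matrix ι ι ℂ} (hA : A ∈ V) : ∃ c : ℂ, c • Q = Q * (A * Q) := by
  have hQmem : Q ∈ compress Q V := ⟨1, hV, by simp [hQ]⟩
  have hAmem : Q * (A * Q) ∈ compress Q V := ⟨A, hA, by simp⟩
  have hne : (⟨Q, hQmem⟩ : compress Q V) ≠ 0 := fun h => hQ0 (congrArg Subtype.val h)
  obtain ⟨c, hc⟩ := (finrank_eq_one_iff_of_nonzero' _ hne).1 hdim ⟨_, hAmem⟩
  exact ⟨c, congrArg Subtype.val hc⟩

theorem stmt_0 (n k r : ℕ) (hn : 1 ≤ n) (hk : 1 ≤ k)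
    (P : Fin r → Matrix (Fin n) (Fin n) ℂ)
    (hproj : ∀ i, IsOrthogonalProjection (P i))
    (hrank : ∀ i, (P i).rank ≤ k)
    (hsum : ∑ i, P i = 1) :
    ¬ HasQuantumAnticlique (Submodule.span ℂ (Set.range P)) (k + 1) := by
  rintro ⟨Q, ⟨hQ, -⟩, hQrank, hdim⟩
  have hQ0 : Q ≠ 0 := by
    rintro rfl
    simp at hQrank
  have hmem (i : Fin r) : P i ∈ Submodule.span ℂ (Set.range P) :=
    Submodule.subset_span ⟨i, rfl⟩
  have hone : (1 : Matrix (Fin n) (Fin n) ℂ) ∈ Submodule.span ℂ (Set.range P) :=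
    hsum ▸ Submodule.sum_mem _ fun i _ => hmem i
  have hzero (i : Fin r) : Q * (P i * Q) = 0 := by
    obtain ⟨c, hc⟩ := exists_smul_eq_of_finrank_compress_eq_one hQ hQ0 hone hdim (hmem i)
    by_cases hc0 : c = 0
    · rw [← hc, hc0, zero_smul]
    · have hle : Q.rank ≤ (P i).rank := by
        have hQeq : Q = (c⁻¹ • Q) * (P i * Q) := by
          rw [smul_mul_assoc, ← hc, smul_smul, inv_mul_cancel₀ hc0, one_smul]
        calc Q.rank = ((c⁻¹ • Q) * (P i * Q)).rank := congrArg Matrix.rank hQeq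
          _ ≤ (P i * Q).rank := Matrix.rank_mul_le_right _ _
          _ ≤ (P i).rank := Matrix.rank_mul_le_left _ _
      have := hrank i
      omega
  apply hQ0
  calc Q = Q * ((∑ i, P i) * Q) := by rw [hsum, one_mul, hQ]
    _ = ∑ i, Q * (P i * Q) := by rw [Finset.sum_mul, Finset.mul_sum]
    _ = 0 := Finset.sum_eq_zero fun i _ => hzero i
end

section
/- For all n ≥ 1 and k ≥ 1 there exists an operator system 𝒱 in M_n(ℂ) with dim(𝒱) = ⌈n/k⌉ such that 𝒱 has no quantum (k+1)-anticlique. (Equivalently, the lower quantum Turán number T↓(n,k), defined as the smallest dimension of an operator system in M_n(ℂ) having no quantum (k+1)-anticlique, satisfies T↓(n,k) ≤ ⌈n/k⌉.) -/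
open Matrix

/-- Diagonal matrices that are constant on the fibres of `g`, as a linear map of the values. -/
noncomputable def fiberDiagonal {ι κ : Type*} [DecidableEq ι] (g : ι → κ) :
    (κ → ℂ) →ₗ[ℂ] Matrix ι ι ℂ :=
  (Matrix.diagonalLinearMap ι ℂ ℂ).comp (LinearMap.funLeft ℂ ℂ g)

lemma fiberDiagonal_apply {ι κ : Type*} [DecidableEq ι] (g : ι → κ) (c : κ → ℂ) :
    fiberDiagonal g c = Matrix.diagonal (c ∘ g) := rfl

lemma fiberDiagonal_injective {ι κ : Type*} [DecidableEq ι] {g : ι → κ}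
    (hg : Function.Surjective g) : Function.Injective (fiberDiagonal g) := by
  intro c d h
  exact hg.injective_comp_right (Matrix.diagonal_injective h)

lemma isOperatorSystem_range_fiberDiagonal {ι κ : Type*} [Fintype ι] [DecidableEq ι]
    (g : ι → κ) : IsOperatorSystem (LinearMap.range (fiberDiagonal g)) := by
  refine ⟨⟨1, ?_⟩, ?_⟩
  · rw [fiberDiagonal_apply, ← Matrix.diagonal_one]
    rfl
  · rintro _ ⟨c, rfl⟩
    refine ⟨star c, ?_⟩
    rw [fiberDiagonal_apply, fiberDiagonal_apply, Matrix.diagonal_conjTranspose]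
    rfl

lemma rank_fiberDiagonal_single {ι κ : Type*} [Fintype ι] [DecidableEq ι] [DecidableEq κ]
    (g : ι → κ) (j : κ) :
    (fiberDiagonal g (Pi.single j 1)).rank = Fintype.card {i // g i = j} := by
  rw [fiberDiagonal_apply, Matrix.rank_diagonal]
  exact Fintype.card_congr (Equiv.subtypeEquivRight fun i => by simp [Pi.single_apply])

/-- If all fibres of `g` have at most `k` elements, the associated operator system
has no anticlique of rank above `k`. -/
lemma not_hasQuantumAnticlique_range_fiberDiagonal {ι κ : Type*} [Fintype ι] [DecidableEq ι]
    [Fintype κ] [DecidableEq κ] (g : ι → κ) {k l : ℕ} (hkl : k < l)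
    (hg : ∀ j, Fintype.card {i // g i = j} ≤ k) :
    ¬ HasQuantumAnticlique (LinearMap.range (fiberDiagonal g)) l := by
  rintro ⟨P, ⟨hP, -⟩, hrank, hdim⟩
  set V := LinearMap.range (fiberDiagonal g)
  have hP0 : P ≠ 0 := by
    rintro rfl
    rw [Matrix.rank_zero] at hrank
    omega
  have hmem (A : Matrix ι ι ℂ) (hA : A ∈ V) : P * (A * P) ∈ compress P V := ⟨A, hA, rfl⟩
  have hPV : P ∈ compress P V := by
    simpa [hP] using hmem 1 (isOperatorSystem_range_fiberDiagonal g).1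
  have hscalar (j : κ) : ∃ a : ℂ, a • P = P * (fiberDiagonal g (Pi.single j 1) * P) := by
    obtain ⟨a, ha⟩ := (finrank_eq_one_iff_of_nonzero' (⟨P, hPV⟩ : compress P V)
      (by simpa using hP0)).1 hdim ⟨_, hmem _ ⟨Pi.single j 1, rfl⟩⟩
    exact ⟨a, congrArg Subtype.val ha⟩
  choose a ha using hscalar
  obtain ⟨j, hj⟩ : ∃ j, a j ≠ 0 := by
    by_contra! h
    apply hP0
    have hone : ∑ j, fiberDiagonal g (Pi.single j 1) = 1 := by
      rw [← map_sum, Finset.univ_sum_single (fun _ => (1 : ℂ)), fiberDiagonal_apply,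
        ← Matrix.diagonal_one]
      rfl
    calc P = P * ((∑ j, fiberDiagonal g (Pi.single j 1)) * P) := by rw [hone, one_mul, hP]
      _ = ∑ j, a j • P := by simp only [Finset.sum_mul, Finset.mul_sum, ha]
      _ = 0 := by simp [h]
  have hle : P.rank ≤ (fiberDiagonal g (Pi.single j 1)).rank := by
    have hPj : P = P * (fiberDiagonal g (Pi.single j 1) * ((a j)⁻¹ • P)) := by
      rw [Matrix.mul_smul, Matrix.mul_smul, ← ha, smul_smul, inv_mul_cancel₀ hj, one_smul]
    calc P.rank = (P * (fiberDiagonal g (Pi.single j 1) * ((a j)⁻¹ • P))).rank := by rw [← hPj]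
      _ ≤ _ := (Matrix.rank_mul_le_right _ _).trans (Matrix.rank_mul_le_left _ _)
  rw [hrank, rank_fiberDiagonal_single] at hle
  exact absurd (hle.trans (hg j)) (by omega)

theorem stmt_1 (n k : ℕ) (hn : 1 ≤ n) (hk : 1 ≤ k) :
    ∃ V : Submodule ℂ (Matrix (Fin n) (Fin n) ℂ),
      IsOperatorSystem V ∧
      Module.finrank ℂ V = ⌈(n : ℚ) / (k : ℚ)⌉₊ ∧
      ¬ HasQuantumAnticlique V (k + 1) := by
  have hlt (j : ℕ) : j < ⌈(n : ℚ) / (k : ℚ)⌉₊ ↔ j * k < n := by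
    rw [Nat.lt_ceil, lt_div_iff₀ (by exact_mod_cast hk)]
    exact_mod_cast Iff.rfl
  let g : Fin n → Fin ⌈(n : ℚ) / (k : ℚ)⌉₊ := fun i =>
    ⟨i / k, (hlt _).2 ((Nat.div_mul_le_self _ _).trans_lt i.2)⟩
  have hg : Function.Surjective g := fun j =>
    ⟨⟨j * k, (hlt _).1 j.2⟩, Fin.ext (Nat.mul_div_cancel _ hk)⟩
  refine ⟨LinearMap.range (fiberDiagonal g), isOperatorSystem_range_fiberDiagonal g, ?_,
    not_hasQuantumAnticlique_range_fiberDiagonal g k.lt_succ_self fun j => ?_⟩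
  · rw [LinearMap.finrank_range_of_inj (fiberDiagonal_injective hg), Module.finrank_fin_fun]
  · let r : {i // g i = j} → Fin k := fun i => ⟨i.1 % k, Nat.mod_lt _ hk⟩
    have hr : Function.Injective r := by
      intro x y h
      have hmod : (x.1 : ℕ) % k = y.1 % k := congrArg Fin.val h
      have hdiv : (x.1 : ℕ) / k = y.1 / k := congrArg Fin.val (x.2.trans y.2.symm)
      apply Subtype.ext
      apply Fin.ext
      rw [← Nat.div_add_mod (x.1 : ℕ) k, hmod, hdiv, Nat.div_add_mod]
    simpa using Fintype.card_le_of_injective r hr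
end

section
/- Let P₁, …, P_r (r ≥ 2) be nonzero orthogonal projections in M_n(ℂ) satisfying P₁ + ⋯ + P_r = I_n, and let k be the minimum over all pairs of distinct indices i ≠ j of rank(P_i) + rank(P_j) (the sum of the two smallest ranks of the P_i's). Then every operator system 𝒱₀ that is properly contained in span_ℂ(P₁, …, P_r) has a quantum k-anticlique. -/
open Matrix

/-- Orthogonal projections that sum to the identity are mutually orthogonal. -/
theorem IsOrthogonalProjection.mul_eq_zero_of_sum_eq_one {ι κ : Type*} [Fintype ι] [DecidableEq ι]
    [Fintype κ] [DecidableEq κ] {P : κ → Matrix ι ι ℂ}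
    (hproj : ∀ i, IsOrthogonalProjection (P i)) (hsum : ∑ i, P i = 1) {i j : κ} (hij : j ≠ i) :
    P j * P i = 0 := by
  open scoped ComplexOrder in
  have key : ∀ j, (P j * P i)ᴴ * (P j * P i) = P i * P j * P i := fun j => by
    rw [conjTranspose_mul, (hproj i).2, (hproj j).2, Matrix.mul_assoc, ← Matrix.mul_assoc (P j),
      (hproj j).1, Matrix.mul_assoc]
  have h1 : ∑ j, P i * P j * P i = P i := by
    rw [← Finset.sum_mul, ← Finset.mul_sum, hsum, mul_one, (hproj i).1]
  have h2 : ∑ j ∈ Finset.univ.erase i, P i * P j * P i = 0 := by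
    rw [← Finset.add_sum_erase _ _ (Finset.mem_univ i), (hproj i).1, (hproj i).1] at h1
    simpa using h1
  have h3 : ∑ j ∈ Finset.univ.erase i, trace ((P j * P i)ᴴ * (P j * P i)) = 0 := by
    simp_rw [key]
    rw [← trace_sum, h2, trace_zero]
  rw [Finset.sum_eq_zero_iff_of_nonneg
    fun j _ => (posSemidef_conjTranspose_mul_self (P j * P i)).trace_nonneg] at h3
  exact trace_conjTranspose_mul_self_eq_zero_iff.1 (h3 j (by simp [hij]))

/-- The range of an orthogonal projection of rank at least `#S` contains the range of a partial
isometry whose initial space is spanned by the standard basis vectors indexed by `S`. -/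
theorem IsOrthogonalProjection.exists_partialIsometry {ι κ : Type*} [Fintype ι] [DecidableEq ι]
    [DecidableEq κ] {P : Matrix ι ι ℂ} (hP : IsOrthogonalProjection P)
    (S : Finset κ) (hS : S.card ≤ P.rank) :
    ∃ M : Matrix ι κ ℂ, P * M = M ∧ Mᴴ * M = diagonal fun l => if l ∈ S then 1 else 0 := by
  let L := P.toEuclideanLin
  have hrank : Module.finrank ℂ (LinearMap.range L) = P.rank := by
    rw [rank_eq_finrank_range_toLin P (EuclideanSpace.basisFun ι ℂ).toBasis
      (EuclideanSpace.basisFun ι ℂ).toBasis]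
    rfl
  let b := stdOrthonormalBasis ℂ (LinearMap.range L)
  obtain ⟨e⟩ : Nonempty (S ↪ Fin (Module.finrank ℂ (LinearMap.range L))) :=
    Function.Embedding.nonempty_of_card_le (by simpa [hrank] using hS)
  let v : κ → EuclideanSpace ℂ ι := fun l =>
    if h : l ∈ S then (b (e ⟨l, h⟩) : EuclideanSpace ℂ ι) else 0
  have hv : ∀ l, L (v l) = v l := fun l => by
    by_cases h : l ∈ S
    · obtain ⟨w, hw⟩ := (b (e ⟨l, h⟩)).2
      simp only [v, dif_pos h, ← hw]
      ext x
      simp [L, toLpLin_apply, mulVec_mulVec, hP.1]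
    · simp [v, h]
  refine ⟨of fun x l => v l x, ?_, ?_⟩
  · ext x l
    have := congrArg (fun u : EuclideanSpace ℂ ι => u x) (hv l)
    simpa [L, toLpLin_apply, mulVec, dotProduct, Matrix.mul_apply] using this
  · ext l m
    have hinner : ((of fun x l => v l x)ᴴ * (of fun x l => v l x) : Matrix κ κ ℂ) l m =
        inner ℂ (v l) (v m) := by
      simp [Matrix.mul_apply, PiLp.inner_apply, mul_comm]
    rw [hinner]
    by_cases hl : l ∈ S
    · by_cases hm : m ∈ S
      · have := orthonormal_iff_ite.1 b.orthonormal (e ⟨l, hl⟩) (e ⟨m, hm⟩)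
        simp only [e.injective.eq_iff, Subtype.mk.injEq, Submodule.coe_inner] at this
        simp only [v, dif_pos hl, dif_pos hm, this, diagonal_apply, if_pos hl]
      · have : l ≠ m := fun h => hm (h ▸ hl)
        simp [v, hm, this]
    · simp [v, hl, diagonal_apply]

/-- An operator system properly contained in the span of orthogonal projections that sum to the
identity satisfies a nontrivial real linear relation on coefficients. -/
theorem IsOperatorSystem.exists_real_relation {ι κ : Type*} [Fintype ι] [DecidableEq ι]
    [Fintype κ] {P : κ → Matrix ι ι ℂ} (hproj : ∀ i, IsOrthogonalProjection (P i))
    {V : Submodule ℂ (Matrix ι ι ℂ)} (hV : IsOperatorSystem V)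
    (hlt : V < Submodule.span ℂ (Set.range P)) :
    ∃ c : κ → ℝ, (∃ i, c i ≠ 0) ∧
      ∀ a : κ → ℂ, ∑ i, a i • P i ∈ V → ∑ i, a i * c i = 0 := by
  obtain ⟨x, hx, hxV⟩ := SetLike.exists_of_lt hlt
  obtain ⟨f, hfx, hf⟩ := Submodule.exists_le_ker_of_notMem hxV
  have hne : ∃ i, f (P i) ≠ 0 := by
    by_contra! h
    exact hfx (Submodule.span_le (p := LinearMap.ker f).2 (by rintro _ ⟨i, rfl⟩; exact h i) hx)
  have h1 : ∀ a : κ → ℂ, ∑ i, a i • P i ∈ V → ∑ i, a i * f (P i) = 0 := fun a ha => by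
    simpa using hf ha
  have h2 : ∀ a : κ → ℂ, ∑ i, a i • P i ∈ V → ∑ i, a i * star (f (P i)) = 0 := fun a ha => by
    have := h1 (star a) (by simpa [conjTranspose_sum, (hproj _).2] using hV.2 _ ha)
    simpa using congrArg star this
  obtain ⟨i, hi⟩ := hne
  by_cases hre : (f (P i)).re = 0
  · refine ⟨fun i => (f (P i)).im, ⟨i, fun him => hi (Complex.ext hre him)⟩, fun a ha => ?_⟩
    have h3 : ∑ i, a i * ((f (P i)).im : ℂ) =
        (∑ i, a i * f (P i) - ∑ i, a i * star (f (P i))) / (2 * Complex.I) := by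
      rw [← Finset.sum_sub_distrib, Finset.sum_div]
      refine Finset.sum_congr rfl fun i _ => ?_
      rw [Complex.im_eq_sub_conj, starRingEnd_apply]
      ring
    rw [h3, h1 a ha, h2 a ha]
    simp
  · refine ⟨fun i => (f (P i)).re, ⟨i, hre⟩, fun a ha => ?_⟩
    have h3 : ∑ i, a i * ((f (P i)).re : ℂ) =
        (∑ i, a i * f (P i) + ∑ i, a i * star (f (P i))) / 2 := by
      rw [← Finset.sum_add_distrib, Finset.sum_div]
      refine Finset.sum_congr rfl fun i _ => ?_
      rw [Complex.re_eq_add_conj, starRingEnd_apply]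
      ring
    rw [h3, h1 a ha, h2 a ha]
    simp

/-- An isometry that compresses every element of `V` to a scalar yields an anticlique. -/
theorem hasQuantumAnticlique_of_isometry {ι : Type*} [Fintype ι] [DecidableEq ι]
    {V : Submodule ℂ (Matrix ι ι ℂ)} (hone : 1 ∈ V) {k : ℕ} (hk : k ≠ 0)
    (W : Matrix ι (Fin k) ℂ) (hW : Wᴴ * W = 1)
    (hVW : ∀ A ∈ V, ∃ z : ℂ, Wᴴ * A * W = z • 1) : HasQuantumAnticlique V k := by
  have hidem : W * Wᴴ * (W * Wᴴ) = W * Wᴴ := by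
    rw [Matrix.mul_assoc, ← Matrix.mul_assoc Wᴴ, hW, Matrix.one_mul]
  have hrank : (W * Wᴴ).rank = k := by
    open scoped ComplexOrder in
    rw [rank_self_mul_conjTranspose, ← rank_conjTranspose_mul_self, hW, rank_one, Fintype.card_fin]
  refine ⟨W * Wᴴ, ⟨hidem, by simp⟩, hrank, ?_⟩
  have hspan : compress (W * Wᴴ) V = Submodule.span ℂ {W * Wᴴ} := by
    apply le_antisymm
    · rintro _ ⟨A, hA, rfl⟩
      obtain ⟨z, hz⟩ := hVW A hA
      refine Submodule.mem_span_singleton.2 ⟨z, ?_⟩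
      have : W * Wᴴ * (A * (W * Wᴴ)) = W * (Wᴴ * A * W) * Wᴴ := by simp only [Matrix.mul_assoc]
      simp [this, hz]
    · rw [Submodule.span_singleton_le_iff_mem]
      exact ⟨1, hone, by simpa using hidem⟩
  rw [hspan]
  exact finrank_span_singleton fun h => hk (by rw [← hrank, h, rank_zero])

/-- Compressing a linear combination of mutually orthogonal projections by a sum of matrices with
ranges in the ranges of the projections. -/
theorem conjTranspose_sum_mul_sum_smul_mul_sum {ι κ μ : Type*} [Fintype ι] [DecidableEq ι]
    [Fintype κ] [DecidableEq κ] {P : κ → Matrix ι ι ℂ}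
    (hproj : ∀ i, IsOrthogonalProjection (P i)) (hsum : ∑ i, P i = 1)
    (M : κ → Matrix ι μ ℂ) (hM : ∀ i, P i * M i = M i) (a : κ → ℂ) :
    (∑ i, M i)ᴴ * (∑ i, a i • P i) * ∑ i, M i = ∑ i, a i • ((M i)ᴴ * M i) := by
  have hzero : ∀ i j, j ≠ i → P j * M i = 0 := fun i j hij => by
    rw [← hM i, ← Matrix.mul_assoc,
      IsOrthogonalProjection.mul_eq_zero_of_sum_eq_one hproj hsum hij, Matrix.zero_mul]
  have hPM : ∀ i, P i * ∑ j, M j = M i := fun i => by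
    rw [Matrix.mul_sum, Finset.sum_eq_single i (fun j _ hj => hzero j i hj.symm) (by simp), hM]
  have hMP : ∀ i, (∑ j, M j)ᴴ * M i = (M i)ᴴ * M i := fun i => by
    conv_lhs => rw [← hM i, ← (hproj i).2, ← Matrix.mul_assoc, ← conjTranspose_mul, hPM]
  rw [Matrix.mul_assoc, Matrix.sum_mul, Matrix.mul_sum]
  refine Finset.sum_congr rfl fun i _ => ?_
  rw [Matrix.smul_mul, Matrix.mul_smul, hPM, hMP]

theorem stmt_3 (n r : ℕ) (hr : 2 ≤ r)
    (P : Fin r → Matrix (Fin n) (Fin n) ℂ)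
    (hne : ∀ i, P i ≠ 0)
    (hproj : ∀ i, IsOrthogonalProjection (P i))
    (hsum : ∑ i, P i = 1)
    (k : ℕ)
    (hk : IsLeast {m : ℕ | ∃ i j : Fin r, i ≠ j ∧ m = (P i).rank + (P j).rank} k)
    (V₀ : Submodule ℂ (Matrix (Fin n) (Fin n) ℂ))
    (hV₀ : IsOperatorSystem V₀)
    (hlt : V₀ < Submodule.span ℂ (Set.range P)) :
    HasQuantumAnticlique V₀ k := by
  obtain ⟨c, hc0, hc⟩ := hV₀.exists_real_relation hproj hlt
  have hcsum : ∑ i, c i = 0 := by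
    have := hc 1 (by simpa [hsum] using hV₀.1)
    simpa [← Complex.ofReal_sum] using this
  obtain ⟨i', -, hi'⟩ := Finset.exists_pos_of_sum_zero_of_exists_nonzero c hcsum
    (by simpa using hc0)
  obtain ⟨j', -, hj'⟩ := Finset.exists_pos_of_sum_zero_of_exists_nonzero (fun i => -c i)
    (by simpa using hcsum) (by simpa using hc0)
  obtain ⟨i₀, hi₀, himin⟩ := Finset.exists_min_image (Finset.univ.filter fun i => 0 < c i)
    (fun i => (P i).rank) ⟨i', by simpa using hi'⟩
  obtain ⟨j₀, hj₀, hjmin⟩ := Finset.exists_min_image (Finset.univ.filter fun i => c i < 0)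
    (fun i => (P i).rank) ⟨j', by simpa using hj'⟩
  simp only [Finset.mem_filter, Finset.mem_univ, true_and] at hi₀ himin hj₀ hjmin
  have hkle : k ≤ (P i₀).rank + (P j₀).rank :=
    hk.2 ⟨i₀, j₀, fun h => by rw [h] at hi₀; linarith, rfl⟩
  have hkne : k ≠ 0 := by
    obtain ⟨i, j, -, hij⟩ := hk.1
    have : (P i).rank ≠ 0 := fun h => hne i <| toLin'.injective <| by
      rw [map_zero]
      exact LinearMap.range_eq_bot.1 (Submodule.finrank_eq_zero.1 h)
    omega
  let T : Finset (Fin k) := Finset.univ.filter fun l => l.val < (P i₀).rank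
  have hT : T.card = min k (P i₀).rank := by simp [T, Fin.card_filter_val_lt]
  have hTc : Tᶜ.card ≤ (P j₀).rank := by
    rw [Finset.card_compl, hT, Fintype.card_fin]
    omega
  let S : Fin r → Finset (Fin k) := fun i => if 0 < c i then T else if c i < 0 then Tᶜ else ∅
  have hS : ∀ i, (S i).card ≤ (P i).rank := fun i => by
    by_cases h : 0 < c i
    · simpa only [S, if_pos h, hT] using (min_le_right _ _).trans (himin i h)
    · by_cases h' : c i < 0
      · simpa only [S, if_neg h, if_pos h'] using hTc.trans (hjmin i h')
      · simp [S, h, h']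
  choose N hPN hN using fun i => (hproj i).exists_partialIsometry (S i) (hS i)
  set s : ℝ := ∑ i, (c i)⁺ with hs
  have hspos : 0 < s := Finset.sum_pos' (fun i _ => posPart_nonneg _)
    ⟨i₀, Finset.mem_univ _, posPart_pos hi₀⟩
  let M : Fin r → Matrix (Fin n) (Fin k) ℂ := fun i => ((√(|c i| / s) : ℝ) : ℂ) • N i
  have hM : ∀ i, (M i)ᴴ * M i = ((|c i| / s : ℝ) : ℂ) • ((N i)ᴴ * N i) := fun i => by
    simp only [M, conjTranspose_smul, Matrix.smul_mul, Matrix.mul_smul, smul_smul, Complex.star_def,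
      Complex.conj_ofReal, ← Complex.ofReal_mul]
    rw [Real.mul_self_sqrt (by positivity)]
  have hcompress : ∀ a : Fin r → ℂ, ∑ i, a i • P i ∈ V₀ →
      (∑ i, M i)ᴴ * (∑ i, a i • P i) * ∑ i, M i =
        ((∑ i, a i * ((c i)⁺ : ℝ)) / s) • (1 : Matrix (Fin k) (Fin k) ℂ) := fun a ha => by
    have hneg : ∑ i, a i * ((c i)⁻ : ℝ) = ∑ i, a i * ((c i)⁺ : ℝ) := by
      have h := hc a ha
      rw [← sub_eq_zero, ← neg_eq_zero, neg_sub, ← Finset.sum_sub_distrib, ← h]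
      refine Finset.sum_congr rfl fun i _ => ?_
      rw [← mul_sub, ← Complex.ofReal_sub, posPart_sub_negPart]
    rw [conjTranspose_sum_mul_sum_smul_mul_sum hproj hsum M
      (fun i => by simp only [M, Matrix.mul_smul, hPN])]
    ext l m
    by_cases hlm : l = m
    · subst hlm
      have hcoef : ∀ i, ((|c i| : ℝ) : ℂ) * (if l ∈ S i then 1 else 0) =
          if l ∈ T then (((c i)⁺ : ℝ) : ℂ) else (((c i)⁻ : ℝ) : ℂ) := fun i => by
        rcases lt_trichotomy (c i) 0 with h | h | h
        · by_cases hl : l ∈ T <;>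
            simp [S, h, h.not_gt, hl, abs_of_neg h, posPart_eq_zero.2 h.le, negPart_of_nonpos h.le]
        · simp [h]
        · by_cases hl : l ∈ T <;>
            simp [S, h, hl, abs_of_pos h, negPart_eq_zero.2 h.le, posPart_of_nonneg h.le]
      have hterm : ∀ i, (a i • ((M i)ᴴ * M i)) l l =
          a i * (if l ∈ T then (((c i)⁺ : ℝ) : ℂ) else (((c i)⁻ : ℝ) : ℂ)) / s := fun i => by
        rw [← hcoef, hM, hN]
        simp only [Matrix.smul_apply, diagonal_apply_eq, smul_eq_mul, Complex.ofReal_div]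
        ring
      rw [Matrix.sum_apply, Finset.sum_congr rfl fun i _ => hterm i, ← Finset.sum_div]
      by_cases hl : l ∈ T <;> simp [hl, hneg]
    · simp [Matrix.sum_apply, hM, hN, hlm]
  refine hasQuantumAnticlique_of_isometry hV₀.1 hkne (∑ i, M i) ?_ fun A hA => ?_
  · have h := hcompress 1 (by simpa [hsum] using hV₀.1)
    have hs0 : (s : ℂ) ≠ 0 := by exact_mod_cast hspos.ne'
    simpa [hsum, ← Complex.ofReal_sum, ← hs, div_self hs0] using h
  · obtain ⟨a, rfl⟩ := (Submodule.mem_span_range_iff_exists_fun ℂ).1 (hlt.le hA)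
    exact ⟨_, hcompress a hA⟩
end

section
/- Let n ≥ 1 and let A ∈ M_n(ℂ) be Hermitian. Then the operator system span_ℂ(I_n, A) has a quantum ⌈n/2⌉-anticlique. -/
open Matrix

/-- A real value between two reals is a convex combination of them with squared weights. -/
theorem exists_sq_weights_of_between {x y m : ℝ} (hx : x ≤ m) (hy : m ≤ y) :
    ∃ a b : ℝ, a ^ 2 + b ^ 2 = 1 ∧ a ^ 2 * x + b ^ 2 * y = m := by
  have hm : m ∈ segment ℝ x y := by
    rw [segment_eq_Icc (hx.trans hy)]
    exact ⟨hx, hy⟩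
  obtain ⟨s, t, hs, ht, hst, h⟩ := hm
  refine ⟨√s, √t, ?_, ?_⟩
  · rw [Real.sq_sqrt hs, Real.sq_sqrt ht, hst]
  · rw [Real.sq_sqrt hs, Real.sq_sqrt ht]
    simpa using h

/-- The matrix whose `i`-th column is `a i • e (p i) + b i • e (q i)`. -/
noncomputable def pairedColumns {n k : ℕ} (p q : Fin k → Fin n) (a b : Fin k → ℝ) :
    Matrix (Fin n) (Fin k) ℂ :=
  Matrix.of fun j i => (if j = p i then (a i : ℂ) else 0) + (if j = q i then (b i : ℂ) else 0)

theorem pairedColumns_compress_diagonal {n k : ℕ} {p q : Fin k → Fin n} {a b : Fin k → ℝ}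
    (hp : Function.Injective p) (hq : Function.Injective q)
    (hpq : ∀ i i', p i = q i' → i = i' ∧ a i * b i = 0) {d : Fin n → ℝ} {m : ℝ}
    (hd : ∀ i, a i ^ 2 * d (p i) + b i ^ 2 * d (q i) = m) :
    (pairedColumns p q a b)ᴴ * diagonal (fun j => (d j : ℂ)) * pairedColumns p q a b
      = (m : ℂ) • 1 := by
  ext i i'
  rw [Matrix.mul_apply]
  simp only [mul_diagonal, conjTranspose_apply, pairedColumns, of_apply, star_add, apply_ite star,
    star_zero, RCLike.star_def, Complex.conj_ofReal, add_mul, mul_add, ite_mul, mul_ite, zero_mul,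
    mul_zero, Finset.sum_add_distrib, Finset.sum_ite_eq', Finset.mem_univ,
    if_true, Matrix.smul_apply, one_apply, smul_eq_mul, mul_one]
  by_cases h : i = i'
  · subst h
    have hi : (a i : ℂ) ^ 2 * d (p i) + (b i : ℂ) ^ 2 * d (q i) = m := by exact_mod_cast hd i
    by_cases hc : p i = q i
    · have hab : (a i : ℂ) * b i = 0 := by exact_mod_cast (hpq i i hc).2
      simp only [hc, if_true] at hi ⊢
      linear_combination hi + 2 * d (q i) * hab
    · simp only [hc, Ne.symm hc, if_true, if_false]
      linear_combination hi
  · have h1 : p i ≠ p i' := fun e => h (hp e)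
    have h2 : q i ≠ q i' := fun e => h (hq e)
    have h3 : p i ≠ q i' := fun e => h (hpq _ _ e).1
    have h4 : q i ≠ p i' := fun e => h (hpq _ _ e.symm).1.symm
    simp [h, h1.symm, h2.symm, h3.symm, h4.symm]

theorem pairedColumns_isometry {n k : ℕ} {p q : Fin k → Fin n} {a b : Fin k → ℝ}
    (hp : Function.Injective p) (hq : Function.Injective q)
    (hpq : ∀ i i', p i = q i' → i = i' ∧ a i * b i = 0)
    (hab : ∀ i, a i ^ 2 + b i ^ 2 = 1) :
    (pairedColumns p q a b)ᴴ * pairedColumns p q a b = 1 := by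
  simpa using pairedColumns_compress_diagonal hp hq hpq (d := fun _ => 1) (m := 1)
    (by simpa using hab)

open scoped ComplexOrder in
/-- An isometry `W` with `Wᴴ * A * W` scalar yields an anticlique for `span {1, A}`. -/
theorem hasQuantumAnticlique_of_isometry_s5 {n k : ℕ} (hk : k ≠ 0) {A : Matrix (Fin n) (Fin n) ℂ}
    {W : Matrix (Fin n) (Fin k) ℂ} {m : ℂ} (hW : Wᴴ * W = 1) (hA : Wᴴ * A * W = m • 1) :
    HasQuantumAnticlique (Submodule.span ℂ {(1 : Matrix (Fin n) (Fin n) ℂ), A}) k := by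
  have hPP : W * Wᴴ * (W * Wᴴ) = W * Wᴴ := by
    rw [Matrix.mul_assoc, ← Matrix.mul_assoc Wᴴ, hW, Matrix.one_mul]
  have hPA : W * Wᴴ * (A * (W * Wᴴ)) = m • (W * Wᴴ) := by
    have : W * Wᴴ * (A * (W * Wᴴ)) = W * (Wᴴ * A * W) * Wᴴ := by simp only [Matrix.mul_assoc]
    rw [this, hA]
    simp
  have hrank : (W * Wᴴ).rank = k := by
    rw [rank_self_mul_conjTranspose, ← rank_conjTranspose_mul_self, hW, rank_one,
      Fintype.card_fin]
  refine ⟨W * Wᴴ, ⟨hPP, by simp⟩, hrank, ?_⟩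
  have hspan : compress (W * Wᴴ) (Submodule.span ℂ {(1 : Matrix (Fin n) (Fin n) ℂ), A})
      = Submodule.span ℂ {W * Wᴴ} := by
    rw [compress, Submodule.map_span, Set.image_pair]
    simp only [LinearMap.comp_apply, LinearMap.mulLeft_apply, LinearMap.mulRight_apply, hPA,
      Matrix.one_mul, hPP]
    refine le_antisymm (Submodule.span_le.2 ?_) (Submodule.span_mono (by simp))
    rintro X (rfl | rfl)
    · exact Submodule.mem_span_singleton_self _
    · exact Submodule.smul_mem _ _ (Submodule.mem_span_singleton_self _)
  rw [hspan]
  refine finrank_span_singleton fun h => hk ?_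
  rw [← hrank, h, rank_zero]

theorem stmt_5 (n : ℕ) (hn : 1 ≤ n) (A : Matrix (Fin n) (Fin n) ℂ) (hA : Aᴴ = A) :
    HasQuantumAnticlique (Submodule.span ℂ {(1 : Matrix (Fin n) (Fin n) ℂ), A})
      ⌈(n : ℚ) / 2⌉₊ := by
  obtain ⟨k, hk⟩ : ∃ k, k = ⌈(n : ℚ) / 2⌉₊ := ⟨_, rfl⟩
  have hkn : n ≤ 2 * k := by
    have h : (n : ℚ) / 2 ≤ k := hk ▸ Nat.le_ceil _
    have h' : (n : ℚ) ≤ 2 * k := by linarith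
    exact_mod_cast h'
  have hkn' : 2 * k < n + 2 := by
    have h : (k : ℚ) < (n : ℚ) / 2 + 1 := hk ▸ Nat.ceil_lt_add_one (by positivity)
    have h' : (2 * k : ℚ) < n + 2 := by linarith
    exact_mod_cast h'
  rw [← hk]
  have hH : A.IsHermitian := hA
  set d := hH.eigenvalues
  set σ := Tuple.sort d
  have hmono : Monotone (d ∘ σ) := Tuple.monotone_sort d
  have hle : k ≤ n := by omega
  set m := d (σ ⟨k - 1, by omega⟩)
  let r : Fin k → Fin n := Fin.castLE hle
  have hweights : ∀ i : Fin k, ∃ a b : ℝ, a ^ 2 + b ^ 2 = 1 ∧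
      a ^ 2 * d (σ (r i)) + b ^ 2 * d (σ (r i).rev) = m ∧ (r i = (r i).rev → a * b = 0) := by
    intro i
    have hr : (r i : ℕ) = i := rfl
    have hi := i.2
    by_cases h : r i = (r i).rev
    · refine ⟨1, 0, by norm_num, ?_, by simp⟩
      have hmid : r i = ⟨k - 1, by omega⟩ := by
        have := congrArg Fin.val h
        rw [Fin.val_rev] at this
        ext
        simp only
        omega
      simp [hmid, m]
    · obtain ⟨a, b, hab, hm⟩ := exists_sq_weights_of_between
        (x := d (σ (r i))) (y := d (σ (r i).rev)) (m := m)
        (hmono (by rw [Fin.le_def]; simp only; omega))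
        (hmono (by rw [Fin.le_def, Fin.val_rev]; simp only; omega))
      exact ⟨a, b, hab, hm, fun e => absurd e h⟩
  choose a b hab hm hzero using hweights
  have hr : Function.Injective r := Fin.castLE_injective hle
  have hp : Function.Injective fun i => σ (r i) := σ.injective.comp hr
  have hq : Function.Injective fun i => σ (r i).rev :=
    σ.injective.comp (Fin.rev_injective.comp hr)
  have hpq : ∀ i i', σ (r i) = σ (r i').rev → i = i' ∧ a i * b i = 0 := by
    intro i i' h
    have h := σ.injective h
    have hii : i = i' := by
      have h1 := congrArg Fin.val h
      have h2 : (r i : ℕ) = i := rfl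
      have h3 : (r i' : ℕ) = i' := rfl
      rw [Fin.val_rev] at h1
      ext
      omega
    subst hii
    exact ⟨rfl, hzero i h⟩
  set W := pairedColumns (fun i => σ (r i)) (fun i => σ (r i).rev) a b
  have hWW : Wᴴ * W = 1 := pairedColumns_isometry hp hq hpq hab
  have hWD : Wᴴ * diagonal (fun j => (d j : ℂ)) * W = (m : ℂ) • 1 :=
    pairedColumns_compress_diagonal hp hq hpq hm
  let U : Matrix (Fin n) (Fin n) ℂ := hH.eigenvectorUnitary.val
  have hUU : Uᴴ * U = 1 := Unitary.coe_star_mul_self hH.eigenvectorUnitary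
  have hspec : A = U * diagonal (fun j => (d j : ℂ)) * Uᴴ := by
    have h := hH.spectral_theorem
    rwa [Unitary.conjStarAlgAut_apply] at h
  refine hasQuantumAnticlique_of_isometry_s5 (W := U * W) (m := m) (by omega) ?_ ?_
  · rw [conjTranspose_mul, Matrix.mul_assoc, ← Matrix.mul_assoc Uᴴ, hUU, Matrix.one_mul, hWW]
  · have : (U * W)ᴴ * A * (U * W)
        = Wᴴ * ((Uᴴ * U) * diagonal (fun j => (d j : ℂ)) * (Uᴴ * U)) * W := by
      rw [hspec, conjTranspose_mul]
      simp only [Matrix.mul_assoc]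
    rw [this, hUU, Matrix.one_mul, Matrix.mul_one, hWD]
end

section
/- Let k ≥ 1 and let A₁, …, A_r be positive semidefinite matrices in M_n(ℂ), each of rank at most k, such that dim(ker(A₁ + ⋯ + A_r)) ≤ k. Then the operator system 𝒱 = span_ℂ(I_n, A₁, …, A_r) has no quantum (k+1)-anticlique. -/
open Matrix
open scoped ComplexOrder

/-- If the compression of a positive semidefinite matrix `A` by `B` vanishes, then `A * B = 0`. -/
theorem Matrix.PosSemidef.mul_eq_zero_of_conjTranspose_mul_mul_eq_zero
    {m n : Type*} [Fintype m] [Fintype n]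
    {A : Matrix n n ℂ} (hA : A.PosSemidef) {B : Matrix n m ℂ} (h : Bᴴ * (A * B) = 0) :
    A * B = 0 := by
  classical
  refine Matrix.ext_of_mulVec_single fun j => ?_
  rw [Matrix.zero_mulVec, ← Matrix.mulVec_mulVec, ← hA.dotProduct_mulVec_zero_iff,
    Matrix.star_mulVec, ← Matrix.dotProduct_mulVec, Matrix.mulVec_mulVec, Matrix.mulVec_mulVec,
    Matrix.mul_assoc, h, Matrix.zero_mulVec, dotProduct_zero]

/-- If the compression of `V` by `P ≠ 0` is one-dimensional and `1 ∈ V`, then every element of `V`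
compresses to a multiple of `P`. -/
theorem exists_smul_eq_mul_mul_of_finrank_compress_eq_one
    {ι : Type*} [Fintype ι] [DecidableEq ι] {P : Matrix ι ι ℂ} {V : Submodule ℂ (Matrix ι ι ℂ)}
    (hP : P * P = P) (hP0 : P ≠ 0) (h1 : 1 ∈ V)
    (hdim : Module.finrank ℂ (compress P V) = 1) {A : Matrix ι ι ℂ} (hA : A ∈ V) :
    ∃ c : ℂ, c • P = P * (A * P) := by
  have hPmem : P ∈ compress P V := ⟨1, h1, by simp [hP]⟩
  have hmem : P * (A * P) ∈ compress P V := ⟨A, hA, rfl⟩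
  obtain ⟨c, hc⟩ := (finrank_eq_one_iff_of_nonzero' (⟨P, hPmem⟩ : compress P V)
    (by simpa [Subtype.ext_iff] using hP0)).1 hdim ⟨_, hmem⟩
  exact ⟨c, congrArg Subtype.val hc⟩


theorem stmt_6 (n k r : ℕ) (hk : 1 ≤ k)
    (A : Fin r → Matrix (Fin n) (Fin n) ℂ)
    (hpos : ∀ i, (A i).PosSemidef)
    (hrank : ∀ i, (A i).rank ≤ k)
    (hker : Module.finrank ℂ (LinearMap.ker (∑ i, A i).mulVecLin) ≤ k) :
    ¬ HasQuantumAnticlique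
      (Submodule.span ℂ (insert (1 : Matrix (Fin n) (Fin n) ℂ) (Set.range A)))
      (k + 1) := by
  rintro ⟨P, ⟨hPP, hPH⟩, hPr, hdim⟩
  have hP0 : P ≠ 0 := by
    rintro rfl
    simp at hPr
  have hAP : ∀ i, A i * P = 0 := by
    intro i
    obtain ⟨c, hc⟩ := exists_smul_eq_mul_mul_of_finrank_compress_eq_one hPP hP0
      (Submodule.subset_span (Set.mem_insert _ _)) hdim
      (Submodule.subset_span (Set.mem_insert_of_mem _ (Set.mem_range_self i)))
    apply (hpos i).mul_eq_zero_of_conjTranspose_mul_mul_eq_zero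
    rw [hPH, ← hc]
    by_contra hne
    have hc0 : c ≠ 0 := by
      rintro rfl
      simp at hne
    have hle : P.rank ≤ (A i).rank := by
      have hPeq : P = (c⁻¹ • P) * (A i * P) := by
        rw [Matrix.smul_mul, ← hc, inv_smul_smul₀ hc0]
      calc P.rank = ((c⁻¹ • P) * (A i * P)).rank := congrArg Matrix.rank hPeq
        _ ≤ (A i * P).rank := Matrix.rank_mul_le_right _ _
        _ ≤ (A i).rank := Matrix.rank_mul_le_left _ _
    have := hrank i
    omega
  have hrange : LinearMap.range P.mulVecLin ≤ LinearMap.ker (∑ i, A i).mulVecLin := by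
    rw [LinearMap.range_le_ker_iff, ← Matrix.mulVecLin_mul, Finset.sum_mul]
    simp [hAP]
  have hfin := Submodule.finrank_mono hrange
  change P.rank ≤ _ at hfin
  omega
end

section
/- Let 𝒱 ⊆ M_n(ℂ) be an operator system with dim(𝒱) = d ≥ 2, and let k ≥ 1. If (k−1)d + 1 ≤ ⌈n/(d−1)⌉, then 𝒱 has a quantum k-anticlique. -/
open Matrix

theorem inner_sub_nonneg_of_forall_norm_le {E : Type*} [NormedAddCommGroup E]
    [InnerProductSpace ℝ E] {C : Set E} (hC : Convex ℝ C) {p q : E} (hp : p ∈ C)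
    (hmin : ∀ x ∈ C, ‖p‖ ≤ ‖x‖) (hq : q ∈ C) : 0 ≤ inner ℝ p (q - p) := by
  have : Nonempty C := ⟨⟨p, hp⟩⟩
  have h : ‖(0 : E) - p‖ = ⨅ w : C, ‖(0 : E) - w‖ := by
    simp only [zero_sub, norm_neg]
    exact le_antisymm (le_ciInf fun w => hmin w w.2)
      (ciInf_le (f := fun w : C => ‖(w : E)‖)
        ⟨0, Set.forall_mem_range.2 fun _ => norm_nonneg _⟩ ⟨p, hp⟩)
  simpa [inner_neg_left] using (norm_eq_iInf_iff_real_inner_le_zero hC hp).1 h q hq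

/-- The point of minimal norm in the convex hull of more than `dim E` points is, unless it is
the origin, in the convex hull of all but one of these points. -/
theorem exists_mem_convexHull_image_ne {E ι : Type*} [NormedAddCommGroup E]
    [InnerProductSpace ℝ E] [FiniteDimensional ℝ E] [Fintype ι] (f : ι → E)
    (hcard : Module.finrank ℝ E < Fintype.card ι) {p : E} (hp0 : p ≠ 0)
    (hp : p ∈ convexHull ℝ (Set.range f))
    (hmin : ∀ x ∈ convexHull ℝ (Set.range f), ‖p‖ ≤ ‖x‖) :
    ∃ i₀, p ∈ convexHull ℝ (f '' {i | i ≠ i₀}) := by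
  obtain ⟨α, _, z, w, hz, hind, hw, hw1, hwp⟩ := eq_pos_convex_span_of_mem_convexHull hp
  have hnn : ∀ a, 0 ≤ inner ℝ p (z a - p) := fun a =>
    inner_sub_nonneg_of_forall_norm_le (convex_convexHull ℝ _) hp hmin
      (subset_convexHull ℝ _ (hz ⟨a, rfl⟩))
  have hsum : ∑ a, w a * inner ℝ p (z a - p) = 0 := by
    simp_rw [← real_inner_smul_right, smul_sub, ← inner_sum,
      Finset.sum_sub_distrib, ← Finset.sum_smul, hwp, hw1, one_smul, sub_self, inner_zero_right]
  have hzero : ∀ a, inner ℝ p (z a - p) = 0 := fun a => by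
    have := (Finset.sum_eq_zero_iff_of_nonneg fun a _ => mul_nonneg (hw a).le (hnn a)).1 hsum a
      (Finset.mem_univ a)
    exact (mul_eq_zero.1 this).resolve_left (hw a).ne'
  have hspan : vectorSpan ℝ (Set.range z) ≤ (ℝ ∙ p)ᗮ := by
    rw [vectorSpan_def, Submodule.span_le]
    rintro _ ⟨_, ⟨a, rfl⟩, _, ⟨b, rfl⟩, rfl⟩
    rw [SetLike.mem_coe, Submodule.mem_orthogonal_singleton_iff_inner_right]
    have : z a -ᵥ z b = (z a - p) - (z b - p) := by simp
    simp only [this]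
    rw [inner_sub_right, hzero, hzero, sub_zero]
  have h1 := hind.card_le_finrank_succ
  have h2 := Submodule.finrank_mono hspan
  have h3 := (ℝ ∙ p).finrank_add_finrank_orthogonal
  rw [finrank_span_singleton hp0] at h3
  choose g hg using fun a => hz ⟨a, rfl⟩
  obtain ⟨i₀, hi₀⟩ : ∃ i₀, ∀ a, g a ≠ i₀ := by
    by_contra! h
    have := Fintype.card_le_of_surjective g h
    omega
  refine ⟨i₀, mem_convexHull_of_exists_fintype w z (fun a => (hw a).le) hw1 (fun a => ?_) hwp⟩
  exact ⟨g a, hi₀ a, hg a⟩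

/-- The colorful Carathéodory theorem. -/
theorem exists_choice_zero_mem_convexHull {E ι κ : Type*} [NormedAddCommGroup E]
    [InnerProductSpace ℝ E] [FiniteDimensional ℝ E] [Fintype ι] [Finite κ]
    [Nonempty κ] (c : ι → κ → E) (hcard : Module.finrank ℝ E < Fintype.card ι)
    (hc : ∀ i, 0 ∈ convexHull ℝ (Set.range (c i))) :
    ∃ j : ι → κ, 0 ∈ convexHull ℝ (Set.range fun i => c i (j i)) := by
  classical
  have : Nonempty ι := Fintype.card_pos_iff.1 (by omega)
  let K : Set E := ⋃ j : ι → κ, convexHull ℝ (Set.range fun i => c i (j i))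
  have hK : IsCompact K :=
    isCompact_iUnion fun j => (Set.finite_range _).isCompact_convexHull (𝕜 := ℝ)
  have hKne : K.Nonempty := by
    let j : ι → κ := fun _ => Classical.arbitrary κ
    exact ⟨_, Set.mem_iUnion.2 ⟨j, subset_convexHull ℝ _ ⟨Classical.arbitrary ι, rfl⟩⟩⟩
  obtain ⟨p, hpK, hpmin⟩ := hK.exists_isMinOn hKne continuous_norm.continuousOn
  obtain ⟨j, hj⟩ := Set.mem_iUnion.1 hpK
  have hmin : ∀ j' : ι → κ, ∀ x ∈ convexHull ℝ (Set.range fun i => c i (j' i)), ‖p‖ ≤ ‖x‖ :=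
    fun j' x hx => hpmin (Set.mem_iUnion.2 ⟨j', hx⟩)
  by_cases hp0 : p = 0
  · exact ⟨j, hp0 ▸ hj⟩
  exfalso
  obtain ⟨i₀, hi₀⟩ := exists_mem_convexHull_image_ne _ hcard hp0 hj (hmin j)
  obtain ⟨b, hb⟩ : ∃ b, inner ℝ p (c i₀ b) ≤ 0 := by
    by_contra! h
    have hsub : convexHull ℝ (Set.range (c i₀)) ⊆ {x | 0 < inner ℝ p x} := by
      refine convexHull_min ?_ (convex_halfSpace_gt (innerₛₗ ℝ p).isLinear 0)
      rintro _ ⟨b, rfl⟩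
      exact h b
    simpa using hsub (hc i₀)
  have h1 : p ∈ convexHull ℝ (Set.range fun i => c i (Function.update j i₀ b i)) := by
    refine convexHull_mono ?_ hi₀
    rintro _ ⟨i, hi, rfl⟩
    exact ⟨i, by simp [Function.update_of_ne hi]⟩
  have h2 := inner_sub_nonneg_of_forall_norm_le (convex_convexHull ℝ _) h1 (hmin _)
    (subset_convexHull ℝ _ ⟨i₀, congrArg (c i₀) (Function.update_self i₀ b j)⟩)
  rw [inner_sub_right, real_inner_self_eq_norm_sq] at h2
  have : 0 < ‖p‖ := norm_pos_iff.2 hp0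
  nlinarith

theorem exists_weights_of_mem_convexHull_range {E ι : Type*} [AddCommGroup E] [Module ℝ E]
    [Fintype ι] {f : ι → E} {x : E} (hx : x ∈ convexHull ℝ (Set.range f)) :
    ∃ w : ι → ℝ, (∀ i, 0 ≤ w i) ∧ ∑ i, w i = 1 ∧ ∑ i, w i • f i = x := by
  classical
  have hsub : convexHull ℝ (Set.range f) ⊆ Fintype.linearCombination ℝ f '' stdSimplex ℝ ι := by
    refine convexHull_min ?_ ((convex_stdSimplex ℝ ι).linear_image _)
    rintro _ ⟨i, rfl⟩
    exact ⟨Pi.single i 1, single_mem_stdSimplex ℝ i, by simp⟩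
  obtain ⟨w, ⟨hw0, hw1⟩, hw⟩ := hsub hx
  exact ⟨w, hw0, hw1, hw⟩

/-- Tverberg's theorem, in conic form: more than `K * d` vectors of `ℝᵈ` can be coloured with
`K + 1` colours and given weights such that all colour classes have the same weighted sum. -/
theorem exists_coloring_weighted_sum_eq {ι : Type*} [Fintype ι] (K d : ℕ) (v : ι → Fin d → ℝ)
    (hcard : K * d < Fintype.card ι) :
    ∃ (j : ι → Option (Fin K)) (w : ι → ℝ), (∀ i, 0 ≤ w i) ∧ ∑ i, w i = 1 ∧
      ∀ a e, ∑ i, (if j i = a then w i * v i e else 0) =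
        ∑ i, (if j i = none then w i * v i e else 0) := by
  let c : ι → Option (Fin K) → EuclideanSpace ℝ (Fin K × Fin d) := fun i a =>
    WithLp.toLp 2 fun be => (if a = some be.1 then v i be.2 else 0) -
      (if a = none then v i be.2 else 0)
  have hc : ∀ i, 0 ∈ convexHull ℝ (Set.range (c i)) := fun i => by
    refine mem_convexHull_of_exists_fintype (fun _ => ((K : ℝ) + 1)⁻¹) (c i)
      (fun _ => by positivity) ?_ (fun a => ⟨a, rfl⟩) ?_
    · simp
      field_simp
    · rw [← Finset.smul_sum]
      ext be
      simp [c]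
  obtain ⟨j, hj⟩ := exists_choice_zero_mem_convexHull c (by simpa using hcard) hc
  obtain ⟨w, hw0, hw1, hw⟩ := exists_weights_of_mem_convexHull_range hj
  refine ⟨j, w, hw0, hw1, fun a e => ?_⟩
  cases a with
  | none => rfl
  | some b =>
    have := congrArg (fun x : EuclideanSpace ℝ (Fin K × Fin d) => x (b, e)) hw
    simp only [c, WithLp.ofLp_sum, WithLp.ofLp_smul, Finset.sum_apply, Pi.smul_apply, smul_eq_mul,
      mul_sub, mul_ite, mul_zero, Finset.sum_sub_distrib, WithLp.ofLp_zero, Pi.zero_apply] at this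
    exact sub_eq_zero.1 this

open scoped InnerProductSpace in
/-- A non-scalar space of operators admits, in every nonzero subspace `W`, a unit vector `x` such
that being orthogonal to all `A x` imposes at most `dim V - 1` conditions on vectors of `W`. -/
theorem exists_unit_vector_orthogonal_submodule {E : Type*} [NormedAddCommGroup E]
    [InnerProductSpace ℂ E] [FiniteDimensional ℂ E] (V : Submodule ℂ (E →ₗ[ℂ] E))
    (h1 : LinearMap.id ∈ V) (hV : 2 ≤ Module.finrank ℂ V) (W : Submodule ℂ E)
    (hW : 0 < Module.finrank ℂ W) :
    ∃ x ∈ W, ‖x‖ = 1 ∧ ∃ W' ≤ W,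
      Module.finrank ℂ W ≤ Module.finrank ℂ W' + (Module.finrank ℂ V - 1) ∧
      ∀ y ∈ W', ∀ A ∈ V, ⟪A x, y⟫_ℂ = 0 := by
  obtain ⟨A, hA, hA1⟩ : ∃ A ∈ V, A ∉ ℂ ∙ (LinearMap.id : E →ₗ[ℂ] E) := by
    by_contra! h
    have h2 := Submodule.finrank_mono (show V ≤ ℂ ∙ (LinearMap.id : E →ₗ[ℂ] E) from h)
    have h3 := finrank_span_le_card (R := ℂ) ({LinearMap.id} : Set (E →ₗ[ℂ] E))
    simp at h3
    omega
  have : Nontrivial W := Module.finrank_pos_iff.1 hW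
  let Q : E →ₗ[ℂ] W := W.orthogonalProjectionOnto.toLinearMap
  obtain ⟨μ, hμ⟩ := Module.End.exists_eigenvalue (Q ∘ₗ A ∘ₗ W.subtype)
  obtain ⟨x₀, hx₀⟩ := hμ.exists_hasEigenvector
  let x : W := ((‖x₀‖⁻¹ : ℝ) : ℂ) • x₀
  have hxnorm : ‖x‖ = 1 := by
    have := norm_ne_zero_iff.2 hx₀.2
    simp only [x, norm_smul, Complex.norm_real, norm_inv, norm_norm]
    field_simp
  have hx : Q (A x) = μ • x := by
    have := hx₀.apply_eq_smul
    simp only [LinearMap.comp_apply, Submodule.subtype_apply] at this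
    simp only [x, Submodule.coe_smul, map_smul, this]
    rw [smul_comm]
  let g : V →ₗ[ℂ] W := Q ∘ₗ (LinearMap.applyₗ (x : E)) ∘ₗ V.subtype
  have hg : ∀ B : V, g B = Q ((B : E →ₗ[ℂ] E) x) := fun B => rfl
  let B : V := ⟨A, hA⟩ - μ • ⟨LinearMap.id, h1⟩
  have hB0 : B ≠ 0 := by
    intro h
    apply hA1
    rw [Submodule.mem_span_singleton]
    have := congrArg Subtype.val h
    simp only [B, Submodule.coe_sub, Submodule.coe_smul, Submodule.coe_zero] at this
    exact ⟨μ, (sub_eq_zero.1 this).symm⟩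
  have hBker : B ∈ LinearMap.ker g := by
    rw [LinearMap.mem_ker, hg]
    simp only [B, Submodule.coe_sub, Submodule.coe_smul, LinearMap.sub_apply,
      LinearMap.smul_apply, LinearMap.id_apply, map_sub, map_smul, hx]
    simp [Q]
  have hker : 0 < Module.finrank ℂ (LinearMap.ker g) := by
    have : Nontrivial (LinearMap.ker g) :=
      ⟨⟨⟨B, hBker⟩, 0, fun h => hB0 (congrArg Subtype.val h)⟩⟩
    exact Module.finrank_pos (R := ℂ) (M := LinearMap.ker g)
  have hrn := g.finrank_range_add_finrank_ker
  have horth := (LinearMap.range g).finrank_add_finrank_orthogonal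
  refine ⟨x, x.2, hxnorm, (LinearMap.range g)ᗮ.map W.subtype, Submodule.map_subtype_le _ _, ?_, ?_⟩
  · rw [LinearEquiv.finrank_eq (Submodule.equivSubtypeMap W (LinearMap.range g)ᗮ).symm]
    omega
  · rintro _ ⟨y, hy, rfl⟩ C hC
    have := (Submodule.mem_orthogonal _ _).1 hy _ ⟨⟨C, hC⟩, rfl⟩
    rw [hg] at this
    exact (Submodule.inner_orthogonalProjectionOnto_eq_of_mem_right y _).symm.trans this

open scoped InnerProductSpace in
theorem exists_orthonormal_family_diagonalizing {E : Type*} [NormedAddCommGroup E]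
    [InnerProductSpace ℂ E] [FiniteDimensional ℂ E] (V : Submodule ℂ (E →ₗ[ℂ] E))
    (h1 : LinearMap.id ∈ V) (hadj : ∀ A ∈ V, A.adjoint ∈ V) (hV : 2 ≤ Module.finrank ℂ V)
    (m : ℕ) (W : Submodule ℂ E)
    (hW : m * (Module.finrank ℂ V - 1) < Module.finrank ℂ W + (Module.finrank ℂ V - 1)) :
    ∃ x : Fin m → E, (∀ i, x i ∈ W) ∧ (∀ i, ‖x i‖ = 1) ∧
      ∀ A ∈ V, ∀ i j, i ≠ j → ⟪x i, A (x j)⟫_ℂ = 0 := by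
  induction m generalizing W with
  | zero => exact ⟨Fin.elim0, fun i => i.elim0, fun i => i.elim0, fun _ _ i => i.elim0⟩
  | succ m ih =>
    rw [add_mul, one_mul] at hW
    obtain ⟨x, hxW, hx1, W', hW', hdim, horth⟩ :=
      exists_unit_vector_orthogonal_submodule V h1 hV W (by omega)
    obtain ⟨y, hyW, hy1, hy⟩ := ih W' (by omega)
    refine ⟨Fin.cons x y, Fin.cases hxW fun i => hW' (hyW i), Fin.cases hx1 hy1, fun A hA => ?_⟩
    refine Fin.cases (Fin.cases (fun h => absurd rfl h) fun j _ => ?_)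
      fun i => Fin.cases (fun _ => ?_) fun j hij => ?_
    · rw [Fin.cons_zero, Fin.cons_succ, ← LinearMap.adjoint_inner_left]
      exact horth _ (hyW j) _ (hadj A hA)
    · rw [Fin.cons_zero, Fin.cons_succ, inner_eq_zero_symm]
      exact horth _ (hyW i) _ hA
    · exact hy A hA i j fun h => hij (congrArg Fin.succ h)

theorem IsOperatorSystem.exists_isometry_isDiag {n N : ℕ}
    {V : Submodule ℂ (Matrix (Fin n) (Fin n) ℂ)} (hV : IsOperatorSystem V)
    (hd : 2 ≤ Module.finrank ℂ V)
    (hN : N * (Module.finrank ℂ V - 1) < n + (Module.finrank ℂ V - 1)) :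
    ∃ X : Matrix (Fin n) (Fin N) ℂ, Xᴴ * X = 1 ∧ ∀ A ∈ V, (Xᴴ * A * X).IsDiag := by
  let e := Matrix.toEuclideanLin (𝕜 := ℂ) (m := Fin n) (n := Fin n)
  let V' := V.map e.toLinearMap
  have hfin : Module.finrank ℂ V' = Module.finrank ℂ V := e.finrank_map_eq V
  obtain ⟨x, -, hx1, hx⟩ := exists_orthonormal_family_diagonalizing V'
    ⟨1, hV.1, by simp [e]⟩
    (by
      rintro _ ⟨A, hA, rfl⟩
      exact ⟨Aᴴ, hV.2 A hA, Matrix.toEuclideanLin_conjTranspose_eq_adjoint A⟩)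
    (hfin ▸ hd) N ⊤ (by simpa [hfin] using hN)
  have key : ∀ A i j, ((Matrix.of fun r i => x i r)ᴴ * A * (Matrix.of fun r i => x i r)) i j =
      inner ℂ (x i) (e A (x j)) := fun A i j => by
    rw [Matrix.mul_assoc]
    simp only [EuclideanSpace.inner_eq_star_dotProduct, e, Matrix.toLpLin_apply, Matrix.mul_apply,
      dotProduct, Matrix.mulVec, conjTranspose_apply, Matrix.of_apply, Pi.star_apply]
    exact Finset.sum_congr rfl fun _ _ => mul_comm _ _
  refine ⟨Matrix.of fun r i => x i r, ?_, fun A hA i j hij => ?_⟩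
  · ext i j
    have := key 1 i j
    rw [Matrix.mul_one] at this
    rw [this]
    by_cases hij : i = j
    · subst hij
      simp [e, hx1]
    · exact (hx _ ⟨1, hV.1, rfl⟩ i j hij).trans (Matrix.one_apply_ne hij).symm
  · exact (key A i j).trans (hx _ ⟨A, hA, rfl⟩ i j hij)

open scoped ComplexOrder in
theorem hasQuantumAnticlique_of_isometry_s8 {ι κ : Type*} [Fintype ι] [DecidableEq ι] [Fintype κ]
    [DecidableEq κ] [Nonempty κ] {V : Submodule ℂ (Matrix ι ι ℂ)} (h1 : 1 ∈ V)
    (Y : Matrix ι κ ℂ) (hY : Yᴴ * Y = 1) (hYV : ∀ A ∈ V, ∃ c : ℂ, Yᴴ * A * Y = c • 1) :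
    HasQuantumAnticlique V (Fintype.card κ) := by
  have hrank : (Y * Yᴴ).rank = Fintype.card κ := by
    rw [Matrix.rank_self_mul_conjTranspose, ← Matrix.rank_conjTranspose_mul_self, hY,
      Matrix.rank_one]
  have hproj : Y * Yᴴ * (Y * Yᴴ) = Y * Yᴴ := by
    rw [Matrix.mul_assoc, ← Matrix.mul_assoc Yᴴ, hY, Matrix.one_mul]
  refine ⟨Y * Yᴴ, ⟨hproj, by simp⟩, hrank, ?_⟩
  have hcomp : compress (Y * Yᴴ) V = ℂ ∙ (Y * Yᴴ) := by
    refine le_antisymm ?_ ?_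
    · rintro _ ⟨A, hA, rfl⟩
      obtain ⟨c, hc⟩ := hYV A hA
      refine Submodule.mem_span_singleton.2 ⟨c, ?_⟩
      have : Y * Yᴴ * (A * (Y * Yᴴ)) = Y * (Yᴴ * A * Y) * Yᴴ := by simp only [Matrix.mul_assoc]
      simp [this, hc]
    · rw [Submodule.span_singleton_le_iff_mem]
      exact ⟨1, h1, by simpa using hproj⟩
  rw [hcomp, finrank_span_singleton]
  intro h
  rw [h, Matrix.rank_zero] at hrank
  exact Fintype.card_ne_zero hrank.symm

theorem IsOperatorSystem.exists_isHermitian_span_eq {ι : Type*} [Fintype ι] [DecidableEq ι]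
    {V : Submodule ℂ (Matrix ι ι ℂ)} (hV : IsOperatorSystem V) :
    ∃ B : Fin (Module.finrank ℂ V) → Matrix ι ι ℂ, (∀ e, (B e).IsHermitian) ∧
      Submodule.span ℂ (Set.range B) = V := by
  have hspan : Submodule.span ℂ {A | A ∈ V ∧ A.IsHermitian} = V := by
    refine le_antisymm (Submodule.span_le.2 fun A hA => hA.1) fun A hA => ?_
    have hre : A + Aᴴ ∈ Submodule.span ℂ {A | A ∈ V ∧ A.IsHermitian} :=
      Submodule.subset_span ⟨V.add_mem hA (hV.2 A hA), by simp [Matrix.IsHermitian, add_comm]⟩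
    have him : Complex.I • (A - Aᴴ) ∈ Submodule.span ℂ {A | A ∈ V ∧ A.IsHermitian} :=
      Submodule.subset_span ⟨V.smul_mem _ (V.sub_mem hA (hV.2 A hA)), by
        simp [Matrix.IsHermitian, Matrix.conjTranspose_smul, ← smul_neg]⟩
    have : A = (1 / 2 : ℂ) • (A + Aᴴ) + (-Complex.I / 2) • (Complex.I • (A - Aᴴ)) := by
      rw [smul_smul, show -Complex.I / 2 * Complex.I = 1 / 2 by
        rw [div_mul_eq_mul_div, neg_mul, Complex.I_mul_I, neg_neg], ← smul_add]
      simp [← two_smul ℂ A]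
    rw [this]
    exact add_mem (Submodule.smul_mem _ _ hre) (Submodule.smul_mem _ _ him)
  obtain ⟨f, hf, hfspan, -⟩ :=
    Submodule.exists_fun_fin_finrank_span_eq ℂ {A | A ∈ V ∧ A.IsHermitian}
  have hfin : Module.finrank ℂ V =
      Module.finrank ℂ (Submodule.span ℂ {A | A ∈ V ∧ A.IsHermitian}) := by rw [hspan]
  refine ⟨f ∘ finCongr hfin, fun e => (hf _).2, ?_⟩
  rw [Set.range_comp, (finCongr hfin).range_eq_univ, Set.image_univ, hfspan, hspan]

theorem IsOperatorSystem.exists_isometry_scalar {ι κ : Type*} [Fintype ι] [DecidableEq ι]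
    [Fintype κ] [DecidableEq κ] {V : Submodule ℂ (Matrix ι ι ℂ)} (hV : IsOperatorSystem V)
    {K : ℕ} (X : Matrix ι κ ℂ) (hX : Xᴴ * X = 1) (hXV : ∀ A ∈ V, (Xᴴ * A * X).IsDiag)
    (hcard : K * Module.finrank ℂ V < Fintype.card κ) :
    ∃ Y : Matrix ι (Option (Fin K)) ℂ, Yᴴ * Y = 1 ∧ ∀ A ∈ V, ∃ c : ℂ, Yᴴ * A * Y = c • 1 := by
  obtain ⟨B, hB, hspan⟩ := hV.exists_isHermitian_span_eq
  obtain ⟨j, w, hw0, hw1, hw⟩ := exists_coloring_weighted_sum_eq K _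
    (fun i e => ((Xᴴ * B e * X) i i).re) hcard
  have hsum : ∀ A ∈ V, ∀ a, ∑ i, (if j i = a then (w i : ℂ) * (Xᴴ * A * X) i i else 0) =
      ∑ i, (if j i = none then (w i : ℂ) * (Xᴴ * A * X) i i else 0) := by
    intro A hA a
    rw [← hspan] at hA
    induction hA using Submodule.span_induction with
    | mem A hA =>
      obtain ⟨e, rfl⟩ := hA
      have hre : ∀ i, (Xᴴ * B e * X) i i = (((Xᴴ * B e * X) i i).re : ℂ) := fun i =>
        ((Matrix.isHermitian_conjTranspose_mul_mul X (hB e)).coe_re_apply_self i).symm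
      have hcast : ∀ b, ∑ i, (if j i = b then (w i : ℂ) * (Xᴴ * B e * X) i i else 0) =
          ((∑ i, if j i = b then w i * ((Xᴴ * B e * X) i i).re else 0 : ℝ) : ℂ) := fun b => by
        rw [Complex.ofReal_sum]
        refine Finset.sum_congr rfl fun i _ => ?_
        rw [hre i]
        split_ifs <;> simp
      rw [hcast, hcast, hw]
    | zero => simp
    | add A A' _ _ h h' =>
      simp only [Matrix.mul_add, Matrix.add_mul, Matrix.add_apply, mul_add, ite_add_zero,
        Finset.sum_add_distrib, h, h']
    | smul c A _ h =>
      have : ∀ b, ∑ i, (if j i = b then (w i : ℂ) * (Xᴴ * (c • A) * X) i i else 0) =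
          c * ∑ i, (if j i = b then (w i : ℂ) * (Xᴴ * A * X) i i else 0) := fun b => by
        rw [Finset.mul_sum]
        refine Finset.sum_congr rfl fun i _ => ?_
        simp only [Matrix.mul_smul, Matrix.smul_mul, Matrix.smul_apply, smul_eq_mul]
        split_ifs <;> ring
      rw [this, this, h]
  have hmass : ∀ a, ((K : ℂ) + 1) * ∑ i, (if j i = a then (w i : ℂ) else 0) = 1 := by
    have h1 := hsum 1 hV.1
    simp only [Matrix.mul_one, hX, Matrix.one_apply_eq, mul_one] at h1
    intro a
    have h2 : ∑ a, ∑ i, (if j i = a then (w i : ℂ) else 0) = 1 := by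
      rw [Finset.sum_comm]
      simp only [Finset.sum_ite_eq, Finset.mem_univ, if_true]
      exact_mod_cast hw1
    rw [Finset.sum_congr rfl fun b _ => (h1 b).trans (h1 a).symm] at h2
    simpa using h2
  let S : Matrix κ (Option (Fin K)) ℂ :=
    Matrix.of fun i a => if j i = a then ((√((K + 1) * w i) : ℝ) : ℂ) else 0
  have hsqrt : ∀ i, ((√((K + 1) * w i) : ℝ) : ℂ) * ((√((K + 1) * w i) : ℝ) : ℂ) =
      ((K : ℂ) + 1) * w i := fun i => by
    rw [← Complex.ofReal_mul, Real.mul_self_sqrt (mul_nonneg (by positivity) (hw0 i))]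
    push_cast
    rfl
  have hS : ∀ A ∈ V, (X * S)ᴴ * A * (X * S) =
      (((K : ℂ) + 1) * ∑ i, if j i = none then (w i : ℂ) * (Xᴴ * A * X) i i else 0) •
        (1 : Matrix (Option (Fin K)) (Option (Fin K)) ℂ) := by
    intro A hA
    have hassoc : (X * S)ᴴ * A * (X * S) = Sᴴ * (Xᴴ * A * X) * S := by
      simp only [Matrix.conjTranspose_mul, Matrix.mul_assoc]
    rw [hassoc, ← (hXV A hA).diagonal_diag]
    ext a b
    rw [Matrix.mul_apply]
    simp only [Matrix.mul_diagonal, conjTranspose_apply, Matrix.diag_apply, S, Matrix.of_apply,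
      Matrix.smul_apply, Matrix.diagonal_apply_eq, smul_eq_mul]
    by_cases hab : a = b
    · subst hab
      rw [Matrix.one_apply_eq, mul_one, ← hsum A hA a, Finset.mul_sum]
      refine Finset.sum_congr rfl fun i _ => ?_
      split_ifs
      · rw [← mul_assoc, ← hsqrt]
        simp only [Complex.star_def, Complex.conj_ofReal]
        ring
      · simp
    · rw [Matrix.one_apply_ne hab, mul_zero]
      refine Finset.sum_eq_zero fun i _ => ?_
      by_cases hia : j i = a
      · rw [if_neg (c := j i = b) (hia ▸ hab), mul_zero]
      · simp [hia]
  refine ⟨X * S, ?_, fun A hA => ⟨_, hS A hA⟩⟩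
  have h1 := hS 1 hV.1
  simp only [Matrix.mul_one, hX, Matrix.one_apply_eq, mul_one] at h1
  rw [h1, hmass none, one_smul]

theorem stmt_8 (n k d : ℕ) (hk : 1 ≤ k) (hd2 : 2 ≤ d)
    (V : Submodule ℂ (Matrix (Fin n) (Fin n) ℂ)) (hV : IsOperatorSystem V)
    (hd : Module.finrank ℂ V = d)
    (hcond : (k - 1) * d + 1 ≤ ⌈(n : ℚ) / ((d : ℚ) - 1)⌉₊) :
    HasQuantumAnticlique V k := by
  have hd1 : (0 : ℚ) < (d : ℚ) - 1 := by
    have : (2 : ℚ) ≤ d := by exact_mod_cast hd2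
    linarith
  have hn : (k - 1) * d * (d - 1) < n := by
    have h : (((k - 1) * d : ℕ) : ℚ) < n / ((d : ℚ) - 1) := Nat.lt_ceil.1 hcond
    rw [lt_div_iff₀ hd1] at h
    have hcast : ((d - 1 : ℕ) : ℚ) = (d : ℚ) - 1 := by
      rw [Nat.cast_sub (by omega), Nat.cast_one]
    rw [← hcast] at h
    exact_mod_cast h
  obtain ⟨X, hX, hXV⟩ := hV.exists_isometry_isDiag (N := (k - 1) * d + 1) (hd ▸ hd2) (by
    rw [hd, add_mul, one_mul]
    omega)
  obtain ⟨Y, hY, hYV⟩ := hV.exists_isometry_scalar (K := k - 1) X hX hXV (by simp [hd])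
  have := hasQuantumAnticlique_of_isometry_s8 hV.1 Y hY hYV
  rwa [Fintype.card_option, Fintype.card_fin, Nat.sub_add_cancel hk] at this
end

section
/- Let B₁, B₂, B₃ ∈ M₂(ℂ) with B₁ and B₃ Hermitian, and let a ≥ 1 be a real number. Then there exist λ ∈ [0,1], a matrix U in the special unitary group SU(2), and a scalar μ ∈ ℂ such that S B₁ S + C U B₂ S + S B₂* U* C + C U B₃ U* C = μ I₂, where S = diag(√λ, √(λ/a)) and C = diag(√(1−λ), √(1−λ/a)). -/
open Matrix

open Set Metric MeasureTheory

/-- `det (1 + t A)` is a polynomial in `t` of degree at most the dimension. -/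
theorem exists_polynomial_eval_det_one_add_smul {E : Type*} [NormedAddCommGroup E]
    [NormedSpace ℝ E] [FiniteDimensional ℝ E] (A : E →L[ℝ] E) :
    ∃ p : Polynomial ℝ, p.natDegree ≤ Module.finrank ℝ E ∧
      ∀ t : ℝ, p.eval t = (1 + t • A).det := by
  classical
  let b := Module.finBasis ℝ E
  let M := LinearMap.toMatrix b b (A : E →ₗ[ℝ] E)
  refine ⟨Matrix.det ((Polynomial.X : Polynomial ℝ) • M.map Polynomial.C +
    (1 : Matrix _ _ ℝ).map Polynomial.C), ?_, fun t => ?_⟩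
  · simpa using Polynomial.natDegree_det_X_add_C_le M 1
  · rw [ContinuousLinearMap.det, ← LinearMap.det_toMatrix b, ← Polynomial.coe_evalRingHom,
      RingHom.map_det]
    congr 1
    have : ((1 + t • A : E →L[ℝ] E) : E →ₗ[ℝ] E) = LinearMap.id + t • (A : E →ₗ[ℝ] E) := rfl
    rw [this, map_add (LinearMap.toMatrix b b), map_smul (LinearMap.toMatrix b b),
      LinearMap.toMatrix_id]
    ext i j
    by_cases hij : i = j <;> simp [M, hij, add_comm, mul_comm _ t]

/-- A map that is Lipschitz on a closed ball and vanishes on the sphere stays Lipschitz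
when extended by zero. -/
theorem lipschitzWith_indicator_closedBall {E : Type*} [NormedAddCommGroup E] [NormedSpace ℝ E]
    {h : E → E} {R : ℝ} {K : NNReal} (hK : LipschitzOnWith K h (closedBall 0 R))
    (h0 : ∀ x, ‖x‖ = R → h x = 0) : LipschitzWith K ((closedBall 0 R).indicator h) := by
  have key : ∀ x y : E, ‖x‖ ≤ R → R < ‖y‖ → ‖h x‖ ≤ K * ‖x - y‖ := by
    intro x y hx hy
    obtain ⟨s, hs, hsR⟩ : ∃ s ∈ Icc (0 : ℝ) 1, ‖x + s • (y - x)‖ = R := by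
      have hc : ContinuousOn (fun s : ℝ => ‖x + s • (y - x)‖) (Icc 0 1) := by fun_prop
      have := intermediate_value_Icc (zero_le_one' ℝ) hc
      exact this ⟨by simpa using hx, by simpa using hy.le⟩
    have h1 := hK.dist_le_mul x (by simpa using hx) (x + s • (y - x)) (by simp [hsR])
    rw [h0 _ hsR, dist_zero_right, dist_eq_norm] at h1
    refine h1.trans ?_
    have : x - (x + s • (y - x)) = s • (x - y) := by
      rw [← neg_sub x y, smul_neg]; abel
    rw [this, norm_smul, Real.norm_of_nonneg hs.1]
    gcongr
    exact mul_le_of_le_one_left (norm_nonneg _) hs.2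
  refine LipschitzWith.of_dist_le_mul fun x y => ?_
  by_cases hx : ‖x‖ ≤ R <;> by_cases hy : ‖y‖ ≤ R
  · rw [indicator_of_mem (by simpa using hx), indicator_of_mem (by simpa using hy)]
    exact hK.dist_le_mul x (by simpa using hx) y (by simpa using hy)
  · rw [indicator_of_mem (by simpa using hx), indicator_of_notMem (by simpa using hy),
      dist_zero_right, dist_eq_norm]
    exact key x y hx (not_le.1 hy)
  · rw [indicator_of_notMem (by simpa using hx), indicator_of_mem (by simpa using hy),
      dist_zero_left, dist_comm, dist_eq_norm]
    exact key y x hy (not_le.1 hx)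
  · rw [indicator_of_notMem (by simpa using hx), indicator_of_notMem (by simpa using hy)]
    simp; positivity

/-- A perturbation of the identity by a contraction is bijective. -/
theorem bijective_add_of_lipschitz {E : Type*} [NormedAddCommGroup E] [NormedSpace ℝ E]
    [CompleteSpace E] {h : E → E} {K : NNReal} (hK : LipschitzWith K h) (hK1 : K < 1) :
    Function.Bijective (fun x => x + h x) := by
  have hf : ApproximatesLinearOn (fun x => x + h x)
      ((ContinuousLinearEquiv.refl ℝ E : E ≃L[ℝ] E) : E →L[ℝ] E) univ K := by
    rw [ApproximatesLinearOn.approximatesLinearOn_iff_lipschitzOnWith]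
    convert hK.lipschitzOnWith (s := univ) using 1
    ext x; simp
  have hc : Subsingleton E ∨
      K < ‖((ContinuousLinearEquiv.refl ℝ E).symm : E →L[ℝ] E)‖₊⁻¹ := by
    rcases subsingleton_or_nontrivial E with hE | hE
    · exact Or.inl hE
    · right
      have : ((ContinuousLinearEquiv.refl ℝ E).symm : E →L[ℝ] E) = ContinuousLinearMap.id ℝ E := rfl
      rw [this, ContinuousLinearMap.nnnorm_id]
      simpa using hK1
  exact ⟨injOn_univ.1 (hf.injOn hc), hf.surjective hc⟩

/-- For small `t` the map `x + t • h x` permutes the ball, so its Jacobian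
integrates to the volume. -/
theorem integral_det_one_add_smul_fderiv {E : Type*} [NormedAddCommGroup E]
    [NormedSpace ℝ E] [FiniteDimensional ℝ E] [MeasurableSpace E] [BorelSpace E]
    (μ : Measure E) [μ.IsAddHaarMeasure]
    {h : E → E} (hh : ContDiff ℝ 1 h) {R : ℝ} (h0 : ∀ x, ‖x‖ = R → h x = 0) :
    ∃ η > 0, ∀ t ∈ Ico (0 : ℝ) η,
      ∫ x in ball 0 R, (1 + t • fderiv ℝ h x).det ∂μ = μ.real (ball 0 R) := by
  have hcd : Continuous (fderiv ℝ h) := hh.continuous_fderiv (by norm_num)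
  obtain ⟨K, hK⟩ : ∃ K : NNReal, ∀ x ∈ closedBall (0 : E) R, ‖fderiv ℝ h x‖₊ ≤ K := by
    obtain ⟨C, hC⟩ := (isCompact_closedBall (0 : E) R).exists_bound_of_continuousOn hcd.continuousOn
    exact ⟨C.toNNReal, fun x hx => by
      rw [← NNReal.coe_le_coe]; exact (hC x hx).trans (Real.le_coe_toNNReal C)⟩
  have hL : LipschitzOnWith K h (closedBall 0 R) :=
    (convex_closedBall (0 : E) R).lipschitzOnWith_of_nnnorm_fderiv_le
      (fun x _ => (hh.differentiable (by norm_num)).differentiableAt) hK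
  have hL' := lipschitzWith_indicator_closedBall hL h0
  obtain ⟨δ, hδ, hdet⟩ : ∃ δ > 0, ∀ A : E →L[ℝ] E, ‖A‖ < δ → 0 < (1 + A).det := by
    have hc : ContinuousAt (fun A : E →L[ℝ] E => (1 + A).det) 0 :=
      (ContinuousLinearMap.continuous_det.comp (continuous_const.add continuous_id)).continuousAt
    have h1 : (0 : ℝ) < (1 + (0 : E →L[ℝ] E)).det := by
      rw [add_zero, ContinuousLinearMap.det]
      have : ((1 : E →L[ℝ] E) : E →ₗ[ℝ] E) = LinearMap.id := rfl
      rw [this, LinearMap.det_id]; exact one_pos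
    obtain ⟨δ, hδ, H⟩ := Metric.eventually_nhds_iff.1 (hc.eventually (lt_mem_nhds h1))
    exact ⟨δ, hδ, fun A hA => H (by simpa using hA)⟩
  refine ⟨min δ 1 / (K + 1), by positivity, fun t ⟨ht0, ht⟩ => ?_⟩
  have htK : t * K < min δ 1 := by
    rw [lt_div_iff₀ (by positivity)] at ht
    nlinarith
  lift t to NNReal using ht0
  have hbij := bijective_add_of_lipschitz (h := (t : ℝ) • (closedBall 0 R).indicator h)
    (K := t * K) (by
      refine LipschitzWith.of_dist_le_mul fun x y => ?_
      have := hL'.dist_le_mul x y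
      simp only [Pi.smul_apply, dist_smul₀, NNReal.coe_mul]
      rw [Real.norm_of_nonneg t.coe_nonneg, mul_assoc]
      gcongr) (by
      rw [← NNReal.coe_lt_coe]; push_cast; exact htK.trans_le (min_le_right _ _))
  set f : E → E := fun x => x + ((t : ℝ) • (closedBall 0 R).indicator h) x with hf
  have hfout : ∀ x ∉ ball (0 : E) R, f x = x := by
    intro x hx
    have hx : R ≤ ‖x‖ := by simpa using hx
    rcases hx.eq_or_lt with hx | hx
    · simp [hf, indicator, h0 x hx.symm]
    · simp [hf, indicator, not_le.2 hx]
  have himg : f '' ball 0 R = ball 0 R := by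
    have h1 : f '' (ball 0 R)ᶜ = (ball 0 R)ᶜ := by
      exact (image_congr hfout).trans (image_id' _)
    rw [← compl_inj_iff, ← image_compl_eq hbij, h1]
  have hder : ∀ x ∈ ball (0 : E) R,
      HasFDerivWithinAt f (1 + (t : ℝ) • fderiv ℝ h x) (ball 0 R) x := by
    intro x hx
    have h1 : HasFDerivAt (fun x => x + (t : ℝ) • h x) (1 + (t : ℝ) • fderiv ℝ h x) x :=
      (hasFDerivAt_id x).add
        (((hh.differentiable (by norm_num)).differentiableAt).hasFDerivAt.const_smul (t : ℝ))
    refine h1.hasFDerivWithinAt.congr (fun y hy => ?_) ?_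
    · simp [hf, indicator, (mem_ball_zero_iff.1 hy).le]
    · simp [hf, indicator, (mem_ball_zero_iff.1 hx).le]
  have hcv := lintegral_abs_det_fderiv_eq_addHaar_image μ measurableSet_ball hder
    hbij.injective.injOn
  rw [himg] at hcv
  have hpos : ∀ x ∈ ball (0 : E) R, 0 ≤ (1 + (t : ℝ) • fderiv ℝ h x).det := by
    intro x hx
    refine (hdet _ ?_).le
    rw [norm_smul, Real.norm_of_nonneg t.coe_nonneg]
    have := hK x (ball_subset_closedBall hx)
    calc (t : ℝ) * ‖fderiv ℝ h x‖ ≤ t * K := by gcongr; exact this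
      _ < δ := htK.trans_le (min_le_left _ _)
  rw [integral_eq_lintegral_of_nonneg_ae, Measure.real, ← hcv]
  · congr 1
    refine setLIntegral_congr_fun measurableSet_ball fun x hx => ?_
    simp only [abs_of_nonneg (hpos x hx)]
  · exact (ae_restrict_mem measurableSet_ball).mono hpos
  · exact (ContinuousLinearMap.continuous_det.comp
      (continuous_const.add (hcd.const_smul (t : ℝ)))).aestronglyMeasurable

/-- There is no `C¹` map onto a sphere fixing the sphere pointwise. -/
theorem not_exists_contDiff_retraction_sphere {E : Type*} [NormedAddCommGroup E]
    [InnerProductSpace ℝ E] [FiniteDimensional ℝ E] {R : ℝ} (hR : 0 < R) {r : E → E}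
    (hr : ContDiff ℝ 1 r) (hrR : ∀ x, ‖r x‖ = R) (hid : ∀ x, ‖x‖ = R → r x = x) : False := by
  borelize E
  let μ : Measure E := Measure.addHaar
  let h : E → E := fun x => r x - x
  have hh : ContDiff ℝ 1 h := hr.sub contDiff_id
  have hcd : Continuous (fderiv ℝ h) := hh.continuous_fderiv (by norm_num)
  obtain ⟨η, hη, H⟩ := integral_det_one_add_smul_fderiv μ hh
    (R := R) (fun x hx => by simp [h, hid x hx])
  have hsing : ∀ x, (1 + (1 : ℝ) • fderiv ℝ h x).det = 0 := by
    intro x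
    have hdr : HasFDerivAt r (fderiv ℝ r x) x :=
      ((hr.differentiable (by norm_num)) x).hasFDerivAt
    have e : 1 + (1 : ℝ) • fderiv ℝ h x = fderiv ℝ r x := by
      have : fderiv ℝ h x = fderiv ℝ r x - 1 := (hdr.sub (hasFDerivAt_id x)).fderiv
      rw [this]; simp
    rw [e]
    by_contra hne
    have horth : ∀ v, inner ℝ (r x) (fderiv ℝ r x v) = 0 := by
      intro v
      have h1 := hdr.norm_sq
      have h2 : (fun y => ‖r y‖ ^ 2) = fun _ => R ^ 2 := by ext y; rw [hrR]
      rw [h2] at h1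
      have h3 := DFunLike.congr_fun (h1.unique (hasFDerivAt_const (R ^ 2) x)) v
      simpa using h3
    have hu : IsUnit (LinearMap.det (fderiv ℝ r x : E →ₗ[ℝ] E)) := isUnit_iff_ne_zero.2 hne
    obtain ⟨v, hv⟩ := (LinearMap.equivOfDetNeZero _ hne).surjective (r x)
    have hv' : fderiv ℝ r x v = r x := hv
    have h4 := horth v
    rw [hv', real_inner_self_eq_norm_sq, hrR] at h4
    exact hR.ne' (by simpa using h4)
  let n := Module.finrank ℝ E
  let s := Finset.range (n + 1)
  let τ : ℕ → ℝ := fun i => η * i / (n + 1)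
  have hτ : InjOn τ s := by
    intro i _ j _ hij
    have hn : (n : ℝ) + 1 ≠ 0 := by positivity
    simp only [τ] at hij
    field_simp at hij
    exact_mod_cast hij
  have hτη : ∀ i ∈ s, τ i ∈ Ico 0 η := by
    intro i hi
    have hi' : (i : ℝ) < n + 1 := by exact_mod_cast Finset.mem_range.1 hi
    refine ⟨by positivity, ?_⟩
    simp only [τ]
    rw [div_lt_iff₀ (by positivity)]
    gcongr
  have hint : ∀ t : ℝ, IntegrableOn (fun x => (1 + t • fderiv ℝ h x).det) (ball 0 R) μ := by
    intro t
    exact ((ContinuousLinearMap.continuous_det.comp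
      (continuous_const.add (hcd.const_smul t))).continuousOn.integrableOn_compact
        (isCompact_closedBall 0 R)).mono_set ball_subset_closedBall
  have hL : ∀ x, ∑ i ∈ s, (1 + τ i • fderiv ℝ h x).det * (Lagrange.basis s τ i).eval 1 = 0 := by
    intro x
    obtain ⟨p, hp, hpe⟩ := exists_polynomial_eval_det_one_add_smul (fderiv ℝ h x)
    rw [← hsing x, ← hpe 1]
    have hd : p.degree < s.card := by
      refine Polynomial.degree_le_natDegree.trans_lt ?_
      simp only [s, Finset.card_range]
      exact_mod_cast Nat.lt_succ_of_le hp
    conv_rhs => rw [Lagrange.eq_interpolate hτ hd]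
    rw [Lagrange.interpolate_apply, Polynomial.eval_finsetSum]
    refine Finset.sum_congr rfl fun i _ => ?_
    simp [hpe]
  have hsum : ∑ i ∈ s, (Lagrange.basis s τ i).eval 1 = 1 := by
    have := congrArg (Polynomial.eval 1) (Lagrange.sum_basis hτ ⟨0, by simp [s]⟩)
    simpa [Polynomial.eval_finsetSum] using this
  have hfin : μ.real (ball (0 : E) R) = 0 := by
    calc μ.real (ball (0 : E) R)
        = ∑ i ∈ s, μ.real (ball (0 : E) R) * (Lagrange.basis s τ i).eval 1 := by
          rw [← Finset.mul_sum, hsum, mul_one]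
      _ = ∑ i ∈ s, ∫ x in ball 0 R,
            (1 + τ i • fderiv ℝ h x).det * (Lagrange.basis s τ i).eval 1 ∂μ := by
          refine Finset.sum_congr rfl fun i hi => ?_
          rw [integral_mul_const, H _ (hτη i hi)]
      _ = ∫ x in ball 0 R, ∑ i ∈ s,
            (1 + τ i • fderiv ℝ h x).det * (Lagrange.basis s τ i).eval 1 ∂μ :=
          (integral_finsetSum _ fun i _ => (hint (τ i)).mul_const _).symm
      _ = 0 := by simp [hL]
  have hpos : 0 < μ.real (ball (0 : E) R) :=
    ENNReal.toReal_pos (measure_ball_pos μ 0 hR).ne' measure_ball_lt_top.ne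
  exact hpos.ne' hfin

/-- A continuous map that is the identity outside the open unit ball has a zero. -/
theorem exists_eq_zero_of_eq_self_outside_unitBall {E : Type*} [NormedAddCommGroup E]
    [InnerProductSpace ℝ E] [FiniteDimensional ℝ E] {F : E → E} (hF : Continuous F)
    (hid : ∀ x, 1 ≤ ‖x‖ → F x = x) : ∃ x, F x = 0 := by
  by_contra! hne
  obtain ⟨m, hm, hmF⟩ : ∃ m > 0, ∀ x, m ≤ ‖F x‖ := by
    obtain ⟨x₀, -, hx₀⟩ := (isCompact_closedBall (0 : E) 1).exists_isMinOn
      ⟨0, by simp⟩ hF.norm.continuousOn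
    refine ⟨min ‖F x₀‖ 1, lt_min (norm_pos_iff.2 (hne x₀)) one_pos, fun x => ?_⟩
    rcases le_total ‖x‖ 1 with hx | hx
    · exact (min_le_left _ _).trans (hx₀ (by simpa using hx))
    · rw [hid x hx]; exact (min_le_right _ _).trans hx
  have hc : Continuous fun x => F x - x := hF.sub continuous_id
  have hu : UniformContinuous fun x => F x - x := by
    refine HasCompactSupport.uniformContinuous_of_continuous
      (HasCompactSupport.of_support_subset_isCompact (isCompact_closedBall (0 : E) 1) ?_) hc
    intro x hx
    by_contra hx'
    exact hx (by simp [hid x (by simpa using (not_le.1 (by simpa using hx')).le)])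
  obtain ⟨δ, hδ, hδF⟩ := Metric.uniformContinuous_iff.1 hu (m / 2) (half_pos hm)
  obtain ⟨g, hg, hgF⟩ := hc.exists_contDiff_dist_le_of_forall_mem_ball_dist_le
    (lt_min one_pos hδ)
  have hG0 : ∀ x, x + g x ≠ 0 := by
    intro x h0
    have h1 := hgF x (m / 2) fun y hy => (hδF (hy.trans_le (min_le_right _ _))).le
    rw [eq_neg_of_add_eq_zero_right h0, dist_eq_norm, ← norm_neg] at h1
    have h2 : -(-x - (F x - x)) = F x := by abel
    rw [h2] at h1
    linarith [hmF x]
  have hGid : ∀ x, ‖x‖ = 2 → x + g x = x := by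
    intro x hx
    have hz : ∀ y, 1 ≤ ‖y‖ → F y - y = 0 := fun y hy => by rw [hid y hy, sub_self]
    have h1 := hgF x 0 fun y hy => by
      have h2 : dist y x < 1 := hy.trans_le (min_le_left _ _)
      have h3 : ‖x‖ - ‖y‖ ≤ dist y x := by
        rw [dist_comm, dist_eq_norm]; exact norm_sub_norm_le x y
      rw [hz y (by linarith), hz x (by linarith), dist_self]
    rw [hz x (by linarith), dist_zero_right] at h1
    simpa using h1
  have hsm : ContDiff ℝ 1 fun x => x + g x :=
    contDiff_id.add (hg.of_le (by exact_mod_cast le_top))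
  refine not_exists_contDiff_retraction_sphere (R := 2) two_pos
    (r := fun x => (2 * ‖x + g x‖⁻¹) • (x + g x)) ?_ ?_ ?_
  · exact (contDiff_const.mul ((hsm.norm ℝ hG0).inv fun x => norm_ne_zero_iff.2 (hG0 x))).smul hsm
  · intro x
    have := norm_ne_zero_iff.2 (hG0 x)
    rw [norm_smul, Real.norm_of_nonneg (by positivity)]
    field_simp
  · intro x hx
    simp only [hGid x hx, hx]
    norm_num

open scoped unitInterval ComplexConjugate

/-- The inclusion of the unit sphere into the nonzero vectors. -/
def sphereToNonzero (E : Type*) [NormedAddCommGroup E] : C(sphere (0 : E) 1, {p : E // p ≠ 0}) where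
  toFun x := ⟨x, fun h => by simpa [h] using x.2⟩
  continuous_toFun := by fun_prop

/-- The inclusion of the unit sphere into the nonzero vectors is not nullhomotopic. -/
theorem not_homotopic_sphereToNonzero_const {E : Type*} [NormedAddCommGroup E]
    [InnerProductSpace ℝ E] [FiniteDimensional ℝ E] (c : {p : E // p ≠ 0}) :
    ¬ (sphereToNonzero E).Homotopic (ContinuousMap.const _ c) := by
  classical
  rintro ⟨H⟩
  have hunit : ∀ {x : E}, x ≠ 0 → ‖x‖⁻¹ • x ∈ sphere (0 : E) 1 := fun {x} hx => by
    simp [norm_smul, hx]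
  let F : E → E := fun x => if hx : x ≠ 0 then
    max 1 ‖x‖ • (H (projIcc 0 1 zero_le_one (2 - 2 * ‖x‖), ⟨‖x‖⁻¹ • x, hunit hx⟩) : E) else c
  have hF : Continuous F := by
    rw [continuous_iff_continuousAt]
    intro x
    by_cases hx : x = 0
    · subst hx
      refine (continuousAt_const (y := (c : E))).congr ?_
      filter_upwards [ball_mem_nhds (0 : E) (ε := 1 / 2) (by norm_num)] with y hy
      have hy : ‖y‖ < 1 / 2 := by simpa using hy
      simp only [F]
      split_ifs with h0
      · rw [projIcc_of_right_le _ (by linarith)]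
        have : (⟨1, by simp⟩ : I) = 1 := rfl
        simp [this, max_eq_left (show ‖y‖ ≤ 1 by linarith)]
      · rfl
    · have : ContinuousOn F {0}ᶜ := by
        rw [continuousOn_iff_continuous_domRestrict]
        have : ({0}ᶜ : Set E).domRestrict F = fun x : ({0}ᶜ : Set E) => max 1 ‖(x : E)‖ •
            (H (projIcc 0 1 zero_le_one (2 - 2 * ‖(x : E)‖),
              ⟨‖(x : E)‖⁻¹ • (x : E), hunit x.2⟩) : E) := by
          ext ⟨x, hx⟩
          have hx : x ≠ 0 := hx
          simp [F, hx]
        rw [this]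
        have hi : Continuous fun x : ({0}ᶜ : Set E) => ‖(x : E)‖⁻¹ :=
          (continuous_norm.comp continuous_subtype_val).inv₀ fun x => norm_ne_zero_iff.2 x.2
        refine Continuous.smul (by fun_prop) (continuous_subtype_val.comp (H.continuous.comp ?_))
        refine (continuous_projIcc.comp (by fun_prop)).prodMk
          (Continuous.subtype_mk (hi.smul continuous_subtype_val) _)
      exact this.continuousAt (isOpen_compl_singleton.mem_nhds hx)
  obtain ⟨x, hx⟩ := exists_eq_zero_of_eq_self_outside_unitBall hF fun x hx => by
    have h0 : x ≠ 0 := by rintro rfl; norm_num at hx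
    have hn : ‖x‖ ≠ 0 := norm_ne_zero_iff.2 h0
    simp only [F, dif_pos h0]
    rw [projIcc_of_le_left _ (by linarith), max_eq_right hx]
    have : (⟨0, by simp⟩ : I) = 0 := rfl
    rw [this, H.apply_zero]
    simp [sphereToNonzero, smul_smul, hn]
  simp only [F] at hx
  split_ifs at hx with h0
  · rcases smul_eq_zero.1 hx with h | h
    · exact absurd h (by positivity)
    · exact (H _).2 h
  · exact c.2 hx

theorem homotopic_of_segment_ne_zero {X E : Type*} [TopologicalSpace X] [NormedAddCommGroup E]
    [NormedSpace ℝ E] (f g : C(X, {p : E // p ≠ 0}))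
    (h : ∀ x, ∀ t ∈ Icc (0 : ℝ) 1, (1 - t) • (f x : E) + t • (g x : E) ≠ 0) : f.Homotopic g :=
  ⟨{ toFun := fun p => ⟨(1 - (p.1 : ℝ)) • (f p.2 : E) + (p.1 : ℝ) • (g p.2 : E), h p.2 _ p.1.2⟩
     continuous_toFun := by fun_prop
     map_zero_left := fun x => by simp
     map_one_left := fun x => by simp }⟩

/-- The traceless Hermitian matrix with coordinates `B`. -/
def tracelessHermitian (B : ℝ × ℂ) : Matrix (Fin 2) (Fin 2) ℂ :=
  !![(B.1 : ℂ), B.2; conj B.2, -(B.1 : ℂ)]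

/-- The nonnegative eigenvalue of `tracelessHermitian B`. -/
noncomputable def topEigenvalue (B : ℝ × ℂ) : ℝ := √(B.1 ^ 2 + Complex.normSq B.2)

theorem topEigenvalue_nonneg (B : ℝ × ℂ) : 0 ≤ topEigenvalue B := Real.sqrt_nonneg _

theorem topEigenvalue_sq (B : ℝ × ℂ) : topEigenvalue B ^ 2 = B.1 ^ 2 + Complex.normSq B.2 :=
  Real.sq_sqrt (add_nonneg (sq_nonneg _) (Complex.normSq_nonneg _))

theorem topEigenvalue_eq_zero {B : ℝ × ℂ} : topEigenvalue B = 0 ↔ B = 0 := by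
  constructor
  · intro h
    have h1 := topEigenvalue_sq B
    rw [h] at h1
    have h2 := Complex.normSq_nonneg B.2
    have h3 := sq_nonneg B.1
    have h4 : B.1 ^ 2 = 0 := by linarith
    have h5 : Complex.normSq B.2 = 0 := by linarith
    exact Prod.ext (by simpa using h4) (by simpa using h5)
  · rintro rfl
    simp [topEigenvalue]

@[fun_prop]
theorem continuous_topEigenvalue : Continuous topEigenvalue := by
  unfold topEigenvalue
  have := Complex.continuous_normSq
  fun_prop

theorem topEigenvalue_neg (B : ℝ × ℂ) : topEigenvalue (-B) = topEigenvalue B := by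
  simp [topEigenvalue]

@[fun_prop]
theorem continuous_tracelessHermitian : Continuous tracelessHermitian := by
  refine continuous_matrix fun i j => ?_
  fin_cases i <;> fin_cases j <;> simp [tracelessHermitian] <;> fun_prop

theorem tracelessHermitian_neg (B : ℝ × ℂ) : tracelessHermitian (-B) = -tracelessHermitian B := by
  ext i j
  fin_cases i <;> fin_cases j <;> simp [tracelessHermitian]

theorem tracelessHermitian_smul_add_smul (s t : ℝ) (B B' : ℝ × ℂ) :
    tracelessHermitian (s • B + t • B') = s • tracelessHermitian B + t • tracelessHermitian B' := by
  ext i j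
  fin_cases i <;> fin_cases j <;> simp [tracelessHermitian]
  ring

theorem tracelessHermitian_mulVec_mulVec (B : ℝ × ℂ) (v : Fin 2 → ℂ) :
    tracelessHermitian B *ᵥ (tracelessHermitian B *ᵥ v) = topEigenvalue B ^ 2 • v := by
  have h : ((topEigenvalue B ^ 2 : ℝ) : ℂ) = B.1 ^ 2 + conj B.2 * B.2 := by
    rw [topEigenvalue_sq, ← Complex.normSq_eq_conj_mul_self]; push_cast; rfl
  ext i
  rw [Pi.smul_apply, Complex.real_smul, h]
  fin_cases i <;> simp [tracelessHermitian, Matrix.mulVec, dotProduct] <;>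
    ring

theorem sq_eq_topEigenvalue_sq {B : ℝ × ℂ} {v : Fin 2 → ℂ} {k : ℝ} (hv : v ≠ 0)
    (h : tracelessHermitian B *ᵥ v = k • v) : k ^ 2 = topEigenvalue B ^ 2 := by
  have h1 := tracelessHermitian_mulVec_mulVec B v
  rw [h, Matrix.mulVec_smul, h, smul_smul, ← sq] at h1
  exact smul_left_injective ℝ hv h1

theorem exists_top_eigenvector (B : ℝ × ℂ) :
    ∃ d : Fin 2 → ℂ, d ≠ 0 ∧ tracelessHermitian B *ᵥ d = topEigenvalue B • d := by
  by_cases h : ((B.1 + topEigenvalue B : ℝ) : ℂ) = 0 ∧ B.2 = 0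
  · refine ⟨![0, 1], fun h => by simpa using congrFun h 1, ?_⟩
    have h1 : topEigenvalue B = -B.1 := by
      have := Complex.ofReal_eq_zero.1 h.1; linarith
    ext i
    fin_cases i <;> simp [tracelessHermitian, h.2, h1]
  · refine ⟨![((B.1 + topEigenvalue B : ℝ) : ℂ), conj B.2], fun h0 => h ⟨?_, ?_⟩, ?_⟩
    · simpa using congrFun h0 0
    · simpa using congrFun h0 1
    · have h : ((topEigenvalue B ^ 2 : ℝ) : ℂ) = B.1 ^ 2 + conj B.2 * B.2 := by
        rw [topEigenvalue_sq, ← Complex.normSq_eq_conj_mul_self]; push_cast; rfl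
      push_cast at h
      ext i
      fin_cases i
      · simp [tracelessHermitian]
        linear_combination -h
      · simp [tracelessHermitian]
        ring

/-- For directions that are not opposite, the segment from a top eigenvector of the first matrix to
its scaled projection on the top eigenspace of the second one avoids zero. -/
theorem add_smul_ne_zero_of_not_opposite {B B' : ℝ × ℂ} {v : Fin 2 → ℂ} (hv : v ≠ 0)
    (h : tracelessHermitian B *ᵥ v = topEigenvalue B • v)
    (hop : topEigenvalue B' • B + topEigenvalue B • B' ≠ 0) {t : ℝ} (ht : t ∈ Icc (0 : ℝ) 1) :
    (1 - t) • v + t • (tracelessHermitian B' *ᵥ v + topEigenvalue B' • v) ≠ 0 := by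
  intro h0
  have ht0 : t ≠ 0 := by
    rintro rfl
    simp [hv] at h0
  have htpos : 0 < t := lt_of_le_of_ne ht.1 ht0.symm
  have h1 : tracelessHermitian B' *ᵥ v = (-(topEigenvalue B' + (1 - t) / t)) • v := by
    have h2 : t • (tracelessHermitian B' *ᵥ v) = t • ((-(topEigenvalue B' + (1 - t) / t)) • v) := by
      rw [smul_smul]
      have : t * -(topEigenvalue B' + (1 - t) / t) = -(1 - t) - t * topEigenvalue B' := by
        field_simp; ring
      rw [this, sub_smul, neg_smul, mul_smul]
      rw [smul_add, ← add_assoc] at h0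
      rw [← sub_eq_zero, ← h0]
      abel
    exact smul_right_injective _ ht0 h2
  have h3 := sq_eq_topEigenvalue_sq hv h1
  have h4 : 0 ≤ (1 - t) / t := div_nonneg (by linarith [ht.2]) htpos.le
  have h5 : (1 - t) / t = 0 := by
    nlinarith [topEigenvalue_nonneg B']
  rw [h5, add_zero] at h1
  have h6 : tracelessHermitian (topEigenvalue B' • B + topEigenvalue B • B') *ᵥ v =
      (0 : ℝ) • v := by
    rw [tracelessHermitian_smul_add_smul, Matrix.add_mulVec, Matrix.smul_mulVec,
      Matrix.smul_mulVec, h, h1, smul_smul, smul_smul, ← add_smul]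
    congr 1; ring
  have h7 := sq_eq_topEigenvalue_sq hv h6
  exact hop (topEigenvalue_eq_zero.1 (by nlinarith))

/-- `ψ₀` is homotopic to a field of top eigenvectors of the Hermitian matrices given by `B`. -/
def HasEigenvectorLift {X : Type*} [TopologicalSpace X] (ψ₀ : C(X, {p : Fin 2 → ℂ // p ≠ 0}))
    (B : X → ℝ × ℂ) : Prop :=
  ∃ ψ : C(X, {p : Fin 2 → ℂ // p ≠ 0}), ψ₀.Homotopic ψ ∧
    ∀ x, tracelessHermitian (B x) *ᵥ (ψ x : Fin 2 → ℂ) = topEigenvalue (B x) • (ψ x : Fin 2 → ℂ)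

theorem HasEigenvectorLift.of_not_opposite {X : Type*} [TopologicalSpace X]
    {ψ₀ : C(X, {p : Fin 2 → ℂ // p ≠ 0})} {B B' : X → ℝ × ℂ} (h : HasEigenvectorLift ψ₀ B)
    (hB' : Continuous B')
    (hop : ∀ x, topEigenvalue (B' x) • B x + topEigenvalue (B x) • B' x ≠ 0) :
    HasEigenvectorLift ψ₀ B' := by
  obtain ⟨ψ, hψ, he⟩ := h
  have key := fun x (t : ℝ) (ht : t ∈ Icc (0 : ℝ) 1) =>
    add_smul_ne_zero_of_not_opposite (ψ x).2 (he x) (hop x) ht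
  let ψ' : C(X, {p : Fin 2 → ℂ // p ≠ 0}) :=
    { toFun := fun x => ⟨tracelessHermitian (B' x) *ᵥ (ψ x : Fin 2 → ℂ) +
        topEigenvalue (B' x) • (ψ x : Fin 2 → ℂ), by simpa using key x 1 (by simp)⟩
      continuous_toFun := by
        refine Continuous.subtype_mk ?_ _
        exact (Continuous.matrix_mulVec (by fun_prop) (by fun_prop)).add
          (by fun_prop : Continuous fun x => topEigenvalue (B' x) • (ψ x : Fin 2 → ℂ)) }
  refine ⟨ψ', hψ.trans (homotopic_of_segment_ne_zero _ _ key), fun x => ?_⟩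
  simp only [ψ', ContinuousMap.coe_mk]
  rw [Matrix.mulVec_add, Matrix.mulVec_smul, tracelessHermitian_mulVec_mulVec, smul_add,
    smul_smul, ← sq, add_comm]

theorem HasEigenvectorLift.of_homotopy {X : Type*} [TopologicalSpace X] [CompactSpace X]
    {ψ₀ : C(X, {p : Fin 2 → ℂ // p ≠ 0})} {B : I × X → ℝ × ℂ} (hB : Continuous B)
    (hB0 : ∀ p, B p ≠ 0) (h : HasEigenvectorLift ψ₀ fun x => B (0, x)) :
    HasEigenvectorLift ψ₀ fun x => B (1, x) := by
  have hloc : IsLocallyConstant fun t => HasEigenvectorLift ψ₀ fun x => B (t, x) := by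
    rw [IsLocallyConstant.iff_eventually_eq]
    intro t
    have hev : ∀ᶠ s in nhds t, ∀ x ∈ (univ : Set X),
        topEigenvalue (B (s, x)) • B (t, x) + topEigenvalue (B (t, x)) • B (s, x) ≠ 0 := by
      refine isCompact_univ.eventually_forall_of_forall_eventually
        (P := fun s x => topEigenvalue (B (s, x)) • B (t, x) +
          topEigenvalue (B (t, x)) • B (s, x) ≠ 0) fun x _ => ?_
      have hc : Continuous fun z : I × X => topEigenvalue (B (z.1, z.2)) • B (t, z.2) +
          topEigenvalue (B (t, z.2)) • B (z.1, z.2) := by fun_prop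
      refine hc.continuousAt.eventually_ne ?_
      have h0 : topEigenvalue (B (t, x)) ≠ 0 := fun h => hB0 _ (topEigenvalue_eq_zero.1 h)
      simp only [← two_smul ℝ]
      exact smul_ne_zero two_ne_zero (smul_ne_zero h0 (hB0 _))
    filter_upwards [hev] with s hs
    refine propext ⟨fun h => h.of_not_opposite (by fun_prop) fun x => ?_,
      fun h => h.of_not_opposite (by fun_prop) fun x => hs x trivial⟩
    rw [add_comm]; exact hs x trivial
  exact (hloc.apply_eq_of_preconnectedSpace 0 1).mp h

/-- A family on `S³` starting at one whose eigenvector field is homotopic to the inclusion, and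
ending at one that misses a direction, vanishes somewhere. -/
theorem exists_eq_zero_of_hasEigenvectorLift
    {B : I × sphere (0 : EuclideanSpace ℂ (Fin 2)) 1 → ℝ × ℂ} (hB : Continuous B)
    {ψ₀ : C(sphere (0 : EuclideanSpace ℂ (Fin 2)) 1, {p : Fin 2 → ℂ // p ≠ 0})}
    (hψ₀ : ∀ x, (ψ₀ x : Fin 2 → ℂ) = WithLp.ofLp (x : EuclideanSpace ℂ (Fin 2)))
    (h0 : HasEigenvectorLift ψ₀ fun x => B (0, x)) {K : ℝ × ℂ} (hK0 : K ≠ 0)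
    (hK : ∀ x, topEigenvalue K • B (1, x) + topEigenvalue (B (1, x)) • K ≠ 0) :
    ∃ p, B p = 0 := by
  by_contra! hB0
  obtain ⟨ψ, hψ, he⟩ := (h0.of_homotopy hB hB0).of_not_opposite (B' := fun _ => K)
    continuous_const hK
  obtain ⟨e, he0, hee⟩ := exists_top_eigenvector (-K)
  rw [topEigenvalue_neg, tracelessHermitian_neg, Matrix.neg_mulVec, neg_eq_iff_eq_neg] at hee
  have hr : topEigenvalue K ≠ 0 := fun h => hK0 (topEigenvalue_eq_zero.1 h)
  have h1 : ψ.Homotopic (ContinuousMap.const _ ⟨e, he0⟩) := by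
    refine homotopic_of_segment_ne_zero _ _ fun x t ht h => ?_
    simp only [ContinuousMap.const_apply] at h
    have h2 := congrArg (fun v => tracelessHermitian K *ᵥ v) h
    simp only [Matrix.mulVec_add, Matrix.mulVec_smul, he, hee, Matrix.mulVec_zero] at h2
    have h3 : topEigenvalue K • ((1 - t) • (ψ x : Fin 2 → ℂ) - t • e) = 0 := by
      refine Eq.trans ?_ h2
      rw [smul_sub, smul_neg, smul_comm, smul_comm t]; abel
    have h4 := (smul_eq_zero.1 h3).resolve_left hr
    have h5 : (2 * t) • e = 0 := by
      refine Eq.trans ?_ (sub_eq_zero.2 (h.trans h4.symm))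
      rw [two_mul, add_smul]; abel
    have h6 : t = 0 := by simpa [he0] using h5
    subst h6
    simp [(ψ x).2] at h
  let j : C({p : Fin 2 → ℂ // p ≠ 0}, {p : EuclideanSpace ℂ (Fin 2) // p ≠ 0}) :=
    { toFun := fun p => ⟨WithLp.toLp 2 (p : Fin 2 → ℂ), by simpa using p.2⟩
      continuous_toFun := by fun_prop }
  have h2 := (ContinuousMap.Homotopic.refl j).comp (hψ.trans h1)
  refine not_homotopic_sphereToNonzero_const (j ⟨e, he0⟩) ?_
  have h3 : j.comp ψ₀ = sphereToNonzero _ := by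
    ext x : 2
    simp [sphereToNonzero, j, hψ₀]
  rwa [h3] at h2

/-- The traceless part of a Hermitian `2 × 2` matrix, in coordinates. -/
noncomputable def tracelessPart (N : Matrix (Fin 2) (Fin 2) ℂ) : ℝ × ℂ :=
  ((N 0 0 - N 1 1).re / 2, N 0 1)

@[fun_prop]
theorem continuous_tracelessPart : Continuous tracelessPart := by
  unfold tracelessPart
  fun_prop

theorem eq_smul_one_add_tracelessHermitian {N : Matrix (Fin 2) (Fin 2) ℂ} (hN : Nᴴ = N) :
    N = (N.trace / 2) • (1 : Matrix (Fin 2) (Fin 2) ℂ) + tracelessHermitian (tracelessPart N) := by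
  have h00 : conj (N 0 0) = N 0 0 := congrFun (congrFun hN 0) 0
  have h11 : conj (N 1 1) = N 1 1 := congrFun (congrFun hN 1) 1
  have h10 : conj (N 0 1) = N 1 0 := congrFun (congrFun hN 1) 0
  have hre : (((N 0 0 - N 1 1).re / 2 : ℝ) : ℂ) = (N 0 0 - N 1 1) / 2 := by
    rw [Complex.ofReal_div, Complex.conj_eq_iff_re.1 (by rw [map_sub, h00, h11])]
    norm_num
  ext i j
  fin_cases i <;> fin_cases j <;>
    simp [tracelessHermitian, tracelessPart, Matrix.trace_fin_two, h10, -Complex.ofReal_div] <;>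
    rw [← Complex.sub_re, hre] <;> ring

theorem tracelessHermitian_tracelessPart_conj {N U : Matrix (Fin 2) (Fin 2) ℂ} (hN : Nᴴ = N)
    (hU : U ∈ Matrix.unitaryGroup (Fin 2) ℂ) :
    tracelessHermitian (tracelessPart (U * N * Uᴴ)) =
      U * tracelessHermitian (tracelessPart N) * Uᴴ := by
  have hU1 : U * Uᴴ = 1 := Matrix.mem_unitaryGroup_iff.1 hU
  have hU2 : Uᴴ * U = 1 := Matrix.mem_unitaryGroup_iff'.1 hU
  have h1 := eq_smul_one_add_tracelessHermitian (N := U * N * Uᴴ)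
    (by simp [Matrix.conjTranspose_mul, hN, Matrix.mul_assoc])
  have h2 := eq_smul_one_add_tracelessHermitian hN
  have h3 : (U * N * Uᴴ).trace = N.trace := by
    rw [Matrix.trace_mul_comm, ← Matrix.mul_assoc, hU2, Matrix.one_mul]
  rw [h3] at h1
  have h4 : U * N * Uᴴ = (N.trace / 2) • (1 : Matrix (Fin 2) (Fin 2) ℂ) +
      U * tracelessHermitian (tracelessPart N) * Uᴴ := by
    conv_lhs => rw [h2]
    simp [Matrix.mul_add, Matrix.add_mul, hU1]
  exact add_left_cancel (h1.symm.trans h4)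

theorem tracelessHermitian_tracelessPart_conj_mulVec {N U : Matrix (Fin 2) (Fin 2) ℂ}
    (hN : Nᴴ = N) (hU : U ∈ Matrix.unitaryGroup (Fin 2) ℂ) {d : Fin 2 → ℂ} (hUd : U *ᵥ d ≠ 0)
    (h : tracelessHermitian (tracelessPart N) *ᵥ d = topEigenvalue (tracelessPart N) • d) :
    tracelessHermitian (tracelessPart (U * N * Uᴴ)) *ᵥ (U *ᵥ d) =
      topEigenvalue (tracelessPart (U * N * Uᴴ)) • (U *ᵥ d) := by
  have hU2 : Uᴴ * U = 1 := Matrix.mem_unitaryGroup_iff'.1 hU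
  have h1 : tracelessHermitian (tracelessPart (U * N * Uᴴ)) *ᵥ (U *ᵥ d) =
      topEigenvalue (tracelessPart N) • (U *ᵥ d) := by
    rw [tracelessHermitian_tracelessPart_conj hN hU, Matrix.mulVec_mulVec, Matrix.mul_assoc, hU2,
      Matrix.mul_one, ← Matrix.mulVec_mulVec, h, Matrix.mulVec_smul]
  rw [h1, (sq_eq_sq₀ (topEigenvalue_nonneg _) (topEigenvalue_nonneg _)).1
    (sq_eq_topEigenvalue_sq hUd h1)]

/-- The quaternionic parametrization of `SU(2)` by the unit vectors of `ℂ²`. -/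
def quaternionMatrix (v : Fin 2 → ℂ) : Matrix (Fin 2) (Fin 2) ℂ :=
  !![v 0, -conj (v 1); v 1, conj (v 0)]

@[fun_prop]
theorem continuous_quaternionMatrix : Continuous quaternionMatrix := by
  refine continuous_matrix fun i j => ?_
  fin_cases i <;> fin_cases j <;> simp [quaternionMatrix] <;> fun_prop

theorem quaternionMatrix_mem_specialUnitaryGroup {v : Fin 2 → ℂ}
    (hv : Complex.normSq (v 0) + Complex.normSq (v 1) = 1) :
    quaternionMatrix v ∈ Matrix.specialUnitaryGroup (Fin 2) ℂ := by
  have h : v 0 * conj (v 0) + v 1 * conj (v 1) = 1 := by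
    rw [Complex.mul_conj, Complex.mul_conj]; exact_mod_cast hv
  rw [Matrix.mem_specialUnitaryGroup_iff]
  constructor
  · rw [Matrix.mem_unitaryGroup_iff, Matrix.star_eq_conjTranspose]
    ext i j
    fin_cases i <;> fin_cases j <;> simp [quaternionMatrix, Matrix.mul_apply] <;>
      first | ring1 | linear_combination h
  · rw [quaternionMatrix, Matrix.det_fin_two_of]
    linear_combination h

theorem normSq_add_normSq_of_mem_sphere {x : EuclideanSpace ℂ (Fin 2)}
    (hx : x ∈ sphere (0 : EuclideanSpace ℂ (Fin 2)) 1) :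
    Complex.normSq (x 0) + Complex.normSq (x 1) = 1 := by
  have h := EuclideanSpace.norm_sq_eq x
  rw [mem_sphere_zero_iff_norm.1 hx] at h
  simpa [Fin.sum_univ_two, Complex.normSq_eq_norm_sq] using h.symm

theorem mem_sphere_of_normSq_add_normSq {v : Fin 2 → ℂ}
    (hv : Complex.normSq (v 0) + Complex.normSq (v 1) = 1) :
    WithLp.toLp 2 v ∈ sphere (0 : EuclideanSpace ℂ (Fin 2)) 1 := by
  rw [mem_sphere_zero_iff_norm, ← sq_eq_sq₀ (norm_nonneg _) zero_le_one, EuclideanSpace.norm_sq_eq]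
  simpa [Fin.sum_univ_two, Complex.normSq_eq_norm_sq] using hv

/-- A complex affine line meets the unit sphere of `ℂ²` in a preconnected set. -/
theorem isPreconnected_sphere_inter_complex_line (α β γ : ℂ) :
    IsPreconnected {v : Fin 2 → ℂ | Complex.normSq (v 0) + Complex.normSq (v 1) = 1 ∧
      α * v 0 + β * v 1 = γ} := by
  by_cases h0 : α = 0 ∧ β = 0
  · obtain ⟨rfl, rfl⟩ := h0
    by_cases hγ : γ = 0
    · subst hγ
      have hr : 1 < Module.rank ℝ (EuclideanSpace ℂ (Fin 2)) := by
        rw [← Module.finrank_eq_rank, finrank_real_of_complex, finrank_euclideanSpace]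
        norm_num
      convert (isPreconnected_sphere hr 0 1).image (fun x => WithLp.ofLp x)
        (by fun_prop : Continuous _).continuousOn using 1
      ext v
      constructor
      · rintro ⟨hv, -⟩
        exact ⟨_, mem_sphere_of_normSq_add_normSq hv, rfl⟩
      · rintro ⟨x, hx, rfl⟩
        exact ⟨normSq_add_normSq_of_mem_sphere hx, by simp⟩
    · convert isPreconnected_empty using 1
      ext v
      simp [Ne.symm hγ]
  · have hn : (α * conj α + β * conj β : ℂ) ≠ 0 := by
      rw [Complex.mul_conj, Complex.mul_conj]
      intro h
      have h1 : Complex.normSq α + Complex.normSq β = 0 := by exact_mod_cast h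
      have h2 := Complex.normSq_nonneg α
      have h3 := Complex.normSq_nonneg β
      exact h0 ⟨Complex.normSq_eq_zero.1 (by linarith), Complex.normSq_eq_zero.1 (by linarith)⟩
    set n : ℂ := α * conj α + β * conj β with hndef
    have hnc : conj n = n := by simp [n, mul_comm]
    let φ : ℂ → Fin 2 → ℂ := fun τ =>
      ![conj α * γ / n - conj (conj β) * τ, conj β * γ / n + conj (conj α) * τ]
    have hline : ∀ τ, α * φ τ 0 + β * φ τ 1 = γ := by
      intro τ
      simp [φ]
      field_simp
      rw [hndef]; ring
    have hnorm : ∀ τ, φ τ 0 * conj (φ τ 0) + φ τ 1 * conj (φ τ 1) =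
        γ * conj γ / n + n * (τ * conj τ) := by
      intro τ
      simp [φ, hnc]
      field_simp
      rw [hndef]; ring
    have hsurj : ∀ v : Fin 2 → ℂ, α * v 0 + β * v 1 = γ →
        φ ((conj α * v 1 - conj β * v 0) / n) = v := by
      intro v hv
      ext i
      fin_cases i
      · simp [φ]
        field_simp
        rw [hndef, ← hv]; ring
      · simp [φ]
        field_simp
        rw [hndef, ← hv]; ring
    have hφ : Continuous φ := by
      refine continuous_pi fun i => ?_
      fin_cases i <;> simp [φ] <;> fun_prop
    have hiff : ∀ v : Fin 2 → ℂ, Complex.normSq (v 0) + Complex.normSq (v 1) = 1 ↔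
        v 0 * conj (v 0) + v 1 * conj (v 1) = 1 := by
      intro v
      rw [Complex.mul_conj, Complex.mul_conj]; norm_cast
    rcases eq_empty_or_nonempty {v : Fin 2 → ℂ | Complex.normSq (v 0) + Complex.normSq (v 1) = 1 ∧
      α * v 0 + β * v 1 = γ} with he | ⟨v₀, hv₀, hl₀⟩
    · rw [he]; exact isPreconnected_empty
    · set τ₀ := (conj α * v₀ 1 - conj β * v₀ 0) / n with hτ₀
      have hτn : ∀ τ, Complex.normSq (φ τ 0) + Complex.normSq (φ τ 1) = 1 ↔ ‖τ‖ = ‖τ₀‖ := by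
        intro τ
        have h1 := hnorm τ₀
        rw [hsurj v₀ hl₀, (hiff v₀).1 hv₀] at h1
        rw [hiff, hnorm, h1, add_right_inj, mul_right_inj' hn, Complex.mul_conj, Complex.mul_conj,
          Complex.ofReal_inj, Complex.normSq_eq_norm_sq, Complex.normSq_eq_norm_sq,
          sq_eq_sq₀ (norm_nonneg _) (norm_nonneg _)]
      convert (isPreconnected_sphere (E := ℂ) (by simp) 0 ‖τ₀‖).image φ
        hφ.continuousOn using 1
      ext v
      constructor
      · rintro ⟨hv, hl⟩
        refine ⟨_, ?_, hsurj v hl⟩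
        rw [mem_sphere_zero_iff_norm, ← hτn, hsurj v hl]
        exact hv
      · rintro ⟨τ, hτ, rfl⟩
        exact ⟨(hτn τ).2 (mem_sphere_zero_iff_norm.1 hτ), hline τ⟩

/-- The compression `S B₁ S + C U B₂ S + S B₂ᴴ Uᴴ C + C U B₃ Uᴴ C` for the angles given by `l`. -/
noncomputable def angleCompression (B₁ B₂ B₃ : Matrix (Fin 2) (Fin 2) ℂ) (a l : ℝ)
    (U : Matrix (Fin 2) (Fin 2) ℂ) : Matrix (Fin 2) (Fin 2) ℂ :=
  let S : Matrix (Fin 2) (Fin 2) ℂ :=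
    Matrix.diagonal ![(Real.sqrt l : ℂ), (Real.sqrt (l / a) : ℂ)]
  let C : Matrix (Fin 2) (Fin 2) ℂ :=
    Matrix.diagonal ![(Real.sqrt (1 - l) : ℂ), (Real.sqrt (1 - l / a) : ℂ)]
  S * B₁ * S + C * U * B₂ * S + S * B₂ᴴ * Uᴴ * C + C * U * B₃ * Uᴴ * C

section angleCompression

variable (B₁ B₂ B₃ : Matrix (Fin 2) (Fin 2) ℂ) (a : ℝ)

theorem continuous_angleCompression :
    Continuous fun p : ℝ × Matrix (Fin 2) (Fin 2) ℂ => angleCompression B₁ B₂ B₃ a p.1 p.2 := by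
  have hS : Continuous fun p : ℝ × Matrix (Fin 2) (Fin 2) ℂ =>
      Matrix.diagonal ![(Real.sqrt p.1 : ℂ), (Real.sqrt (p.1 / a) : ℂ)] := by
    refine Continuous.matrix_diagonal (continuous_pi fun i => ?_)
    fin_cases i <;> simp <;> fun_prop
  have hC : Continuous fun p : ℝ × Matrix (Fin 2) (Fin 2) ℂ =>
      Matrix.diagonal ![(Real.sqrt (1 - p.1) : ℂ), (Real.sqrt (1 - p.1 / a) : ℂ)] := by
    refine Continuous.matrix_diagonal (continuous_pi fun i => ?_)
    fin_cases i <;> simp <;> fun_prop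
  unfold angleCompression
  fun_prop

theorem conjTranspose_angleCompression (h1 : B₁ᴴ = B₁) (h3 : B₃ᴴ = B₃) (l : ℝ)
    (U : Matrix (Fin 2) (Fin 2) ℂ) :
    (angleCompression B₁ B₂ B₃ a l U)ᴴ = angleCompression B₁ B₂ B₃ a l U := by
  have hd : ∀ s t : ℝ, star ![(s : ℂ), (t : ℂ)] = ![(s : ℂ), (t : ℂ)] := by
    intro s t
    ext i
    fin_cases i <;> simp
  simp only [angleCompression, Matrix.conjTranspose_add, Matrix.conjTranspose_mul,
    Matrix.diagonal_conjTranspose, hd, Matrix.conjTranspose_conjTranspose, h1, h3,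
    Matrix.mul_assoc]
  abel

theorem angleCompression_zero (U : Matrix (Fin 2) (Fin 2) ℂ) :
    angleCompression B₁ B₂ B₃ a 0 U = U * B₃ * Uᴴ := by
  have h0 : Matrix.diagonal ![(0 : ℂ), 0] = 0 := by
    ext i j; fin_cases i <;> fin_cases j <;> simp
  have h1 : Matrix.diagonal ![(1 : ℂ), 1] = 1 := by
    ext i j; fin_cases i <;> fin_cases j <;> simp
  simp [angleCompression, h0, h1]

theorem angleCompression_one_apply_zero_one (U : Matrix (Fin 2) (Fin 2) ℂ) :
    angleCompression B₁ B₂ B₃ a 1 U 0 1 = B₁ 0 1 * (√(1 / a) : ℝ) +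
      (conj (B₂ 0 0 * U 1 0) + conj (B₂ 1 0 * U 1 1)) * (√(1 - 1 / a) : ℝ) := by
  simp [angleCompression, Matrix.mul_apply, Fin.sum_univ_two, Matrix.diagonal_apply]

/-- The off-diagonal entry at `l = 1` vanishes on a preconnected subset of `SU(2)`. -/
theorem isPreconnected_angleCompression_one_apply_zero_one_eq_zero :
    IsPreconnected {v : Fin 2 → ℂ | Complex.normSq (v 0) + Complex.normSq (v 1) = 1 ∧
      angleCompression B₁ B₂ B₃ a 1 (quaternionMatrix v) 0 1 = 0} := by
  have h := (isPreconnected_sphere_inter_complex_line (B₂ 1 0 * (√(1 - 1 / a) : ℝ))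
    (B₂ 0 0 * (√(1 - 1 / a) : ℝ)) (-conj (B₁ 0 1) * (√(1 / a) : ℝ))).image
      (fun v => ![conj (v 0), v 1]) (Continuous.continuousOn (by
        refine continuous_pi fun i => ?_
        fin_cases i <;> simp <;> fun_prop))
  have key : ∀ v : Fin 2 → ℂ, angleCompression B₁ B₂ B₃ a 1 (quaternionMatrix v) 0 1 = 0 ↔
      B₂ 1 0 * (√(1 - 1 / a) : ℝ) * conj (v 0) + B₂ 0 0 * (√(1 - 1 / a) : ℝ) * v 1 =
        -conj (B₁ 0 1) * (√(1 / a) : ℝ) := by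
    intro v
    rw [angleCompression_one_apply_zero_one, ← map_eq_zero (starRingEnd ℂ)]
    simp only [quaternionMatrix, map_add, map_mul, Complex.conj_ofReal, Complex.conj_conj,
      Matrix.of_apply, Matrix.cons_val', Matrix.cons_val_zero, Matrix.cons_val_one,
      Matrix.cons_val_fin_one]
    constructor <;> intro h <;> linear_combination h
  convert h using 1
  ext v
  constructor
  · rintro ⟨hv, hv0⟩
    refine ⟨![conj (v 0), v 1], ⟨by simpa using hv, by simpa using (key v).1 hv0⟩, ?_⟩
    ext i
    fin_cases i <;> simp
  · rintro ⟨w, ⟨hw, hw0⟩, rfl⟩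
    exact ⟨by simpa using hw, (key _).2 (by simpa using hw0)⟩

end angleCompression

theorem isUnitary_mulVec_ne_zero {U : Matrix (Fin 2) (Fin 2) ℂ}
    (hU : U ∈ Matrix.unitaryGroup (Fin 2) ℂ) {d : Fin 2 → ℂ} (hd : d ≠ 0) : U *ᵥ d ≠ 0 := by
  intro h
  apply hd
  rw [← Matrix.one_mulVec d, ← Matrix.mem_unitaryGroup_iff'.1 hU, ← Matrix.mulVec_mulVec, h,
    Matrix.mulVec_zero]

/-- The orbit map of a nonzero vector under `SU(2)`. -/
def orbitMap (d : {p : Fin 2 → ℂ // p ≠ 0}) :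
    C(sphere (0 : EuclideanSpace ℂ (Fin 2)) 1, {p : Fin 2 → ℂ // p ≠ 0}) where
  toFun x := ⟨quaternionMatrix (WithLp.ofLp (x : EuclideanSpace ℂ (Fin 2))) *ᵥ (d : Fin 2 → ℂ),
    isUnitary_mulVec_ne_zero (quaternionMatrix_mem_specialUnitaryGroup
      (normSq_add_normSq_of_mem_sphere x.2)).1 d.2⟩
  continuous_toFun :=
    (Continuous.matrix_mulVec (by fun_prop) continuous_const).subtype_mk _

theorem orbitMap_homotopic (d e : {p : Fin 2 → ℂ // p ≠ 0}) :
    (orbitMap d).Homotopic (orbitMap e) := by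
  have hr : 1 < Module.rank ℝ (Fin 2 → ℂ) := by
    rw [← Module.finrank_eq_rank, finrank_real_of_complex, Module.finrank_fin_fun]
    norm_num
  have hp := isPathConnected_iff_pathConnectedSpace.1
    (isPathConnected_compl_singleton_of_one_lt_rank hr (0 : Fin 2 → ℂ))
  obtain ⟨γ⟩ := hp.joined (⟨d, d.2⟩ : ({0}ᶜ : Set (Fin 2 → ℂ))) ⟨e, e.2⟩
  exact ⟨{
    toFun := fun p => orbitMap ⟨γ p.1, (γ p.1).2⟩ p.2
    continuous_toFun := (Continuous.matrix_mulVec (by fun_prop)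
      (continuous_subtype_val.comp (γ.continuous.comp continuous_fst))).subtype_mk _
    map_zero_left := fun x => by simp
    map_one_left := fun x => by simp }⟩

theorem exists_tracelessPart_angleCompression_eq_zero (B₁ B₂ B₃ : Matrix (Fin 2) (Fin 2) ℂ)
    (h3 : B₃ᴴ = B₃) (a : ℝ) :
    ∃ p : I × sphere (0 : EuclideanSpace ℂ (Fin 2)) 1,
      tracelessPart (angleCompression B₁ B₂ B₃ a p.1 (quaternionMatrix
        (WithLp.ofLp (p.2 : EuclideanSpace ℂ (Fin 2))))) = 0 := by
  let G : ℝ × (Fin 2 → ℂ) → ℝ × ℂ := fun p =>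
    tracelessPart (angleCompression B₁ B₂ B₃ a p.1 (quaternionMatrix p.2))
  have hq : Continuous fun p : ℝ × (Fin 2 → ℂ) => (p.1, quaternionMatrix p.2) :=
    continuous_fst.prodMk (continuous_quaternionMatrix.comp continuous_snd)
  have hG : Continuous G := by
    have h := (continuous_tracelessPart.comp (continuous_angleCompression B₁ B₂ B₃ a)).comp hq
    exact h
  let B : I × sphere (0 : EuclideanSpace ℂ (Fin 2)) 1 → ℝ × ℂ := fun p =>
    G (p.1, WithLp.ofLp (p.2 : EuclideanSpace ℂ (Fin 2)))
  change ∃ p, B p = 0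
  have hB : Continuous B := hG.comp (by fun_prop)
  by_contra! hB0
  obtain ⟨d, hd0, hd⟩ := exists_top_eigenvector (tracelessPart B₃)
  have hlift : HasEigenvectorLift (orbitMap ⟨![1, 0], fun h => by simpa using congrFun h 0⟩)
      fun x => B (0, x) := by
    refine ⟨orbitMap ⟨d, hd0⟩, orbitMap_homotopic _ _, fun x => ?_⟩
    have hU := (quaternionMatrix_mem_specialUnitaryGroup
      (normSq_add_normSq_of_mem_sphere x.2)).1
    simp only [B, G, Set.Icc.coe_zero, angleCompression_zero]
    exact tracelessHermitian_tracelessPart_conj_mulVec h3 hU (isUnitary_mulVec_ne_zero hU hd0) hd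
  have hinc : ∀ x, (orbitMap ⟨![1, 0], fun h => by simpa using congrFun h 0⟩ x : Fin 2 → ℂ) =
      WithLp.ofLp (x : EuclideanSpace ℂ (Fin 2)) := by
    intro x
    ext i
    fin_cases i <;> simp [orbitMap, quaternionMatrix]
  have hpole : ∀ ε : ℝ, ε ^ 2 = 1 → ∃ x : sphere (0 : EuclideanSpace ℂ (Fin 2)) 1,
      (B (1, x)).2 = 0 ∧ 0 < -ε * (B (1, x)).1 := by
    intro ε hε
    have hK : topEigenvalue (ε, 0) = 1 := by simp [topEigenvalue, hε]
    by_contra! hno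
    obtain ⟨p, hp⟩ := exists_eq_zero_of_hasEigenvectorLift hB hinc hlift (K := (ε, 0))
      (fun h => by simp [topEigenvalue_eq_zero.2 h] at hK) (fun x h => by
        rw [hK, one_smul] at h
        have h1 : (B (1, x)).1 + topEigenvalue (B (1, x)) * ε = 0 := congrArg Prod.fst h
        have h2 : (B (1, x)).2 = 0 := by simpa using congrArg Prod.snd h
        have h3 := hno x h2
        have h4 : topEigenvalue (B (1, x)) = -ε * (B (1, x)).1 := by
          linear_combination ε * h1 - topEigenvalue (B (1, x)) * hε
        exact hB0 (1, x) (topEigenvalue_eq_zero.1 (le_antisymm (h4 ▸ h3) (topEigenvalue_nonneg _))))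
    exact hB0 p hp
  obtain ⟨x, hx0, hx⟩ := hpole 1 (by norm_num)
  obtain ⟨y, hy0, hy⟩ := hpole (-1) (by norm_num)
  have hconn := isPreconnected_angleCompression_one_apply_zero_one_eq_zero B₁ B₂ B₃ a
  have hc : Continuous fun v : Fin 2 → ℂ => (G (1, v)).1 :=
    continuous_fst.comp (hG.comp (by fun_prop))
  obtain ⟨v, ⟨hv, hv0⟩, hv1⟩ := hconn.intermediate_value
    (a := WithLp.ofLp (x : EuclideanSpace ℂ (Fin 2)))
    (b := WithLp.ofLp (y : EuclideanSpace ℂ (Fin 2)))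
    ⟨normSq_add_normSq_of_mem_sphere x.2, hx0⟩ ⟨normSq_add_normSq_of_mem_sphere y.2, hy0⟩
    hc.continuousOn (show (0 : ℝ) ∈ Icc (B (1, x)).1 (B (1, y)).1 from
      ⟨by linarith, by linarith⟩)
  exact hB0 (1, ⟨_, mem_sphere_of_normSq_add_normSq hv⟩) (Prod.ext hv1 hv0)

theorem stmt_11 (B₁ B₂ B₃ : Matrix (Fin 2) (Fin 2) ℂ)
    (h1 : B₁ᴴ = B₁) (h3 : B₃ᴴ = B₃) (a : ℝ) (ha : 1 ≤ a) :
    ∃ l ∈ Set.Icc (0 : ℝ) 1, ∃ U ∈ Matrix.specialUnitaryGroup (Fin 2) ℂ, ∃ μ : ℂ,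
      let S : Matrix (Fin 2) (Fin 2) ℂ :=
        Matrix.diagonal ![(Real.sqrt l : ℂ), (Real.sqrt (l / a) : ℂ)]
      let C : Matrix (Fin 2) (Fin 2) ℂ :=
        Matrix.diagonal ![(Real.sqrt (1 - l) : ℂ), (Real.sqrt (1 - l / a) : ℂ)]
      S * B₁ * S + C * U * B₂ * S + S * B₂ᴴ * Uᴴ * C + C * U * B₃ * Uᴴ * C =
        μ • (1 : Matrix (Fin 2) (Fin 2) ℂ) := by
  obtain ⟨⟨l, x⟩, hlx⟩ := exists_tracelessPart_angleCompression_eq_zero B₁ B₂ B₃ h3 a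
  have h := eq_smul_one_add_tracelessHermitian
    (conjTranspose_angleCompression B₁ B₂ B₃ a h1 h3 l
      (quaternionMatrix (WithLp.ofLp (x : EuclideanSpace ℂ (Fin 2)))))
  rw [hlx, show tracelessHermitian 0 = 0 by
    ext i j; fin_cases i <;> fin_cases j <;> simp [tracelessHermitian], add_zero] at h
  exact ⟨l, l.2, _, quaternionMatrix_mem_specialUnitaryGroup
    (normSq_add_normSq_of_mem_sphere x.2), _, h⟩
end
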